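/- Let m ≥ 8 be an integer such that m ≡ 0 (mod 4) and m−1 belongs to the set 𝓜. Then there exists N (depending only on m) such that for all n ≥ N, every polynomial f(x) = a₀x^m + a₁x^{m−1} + a₂x^{m−2} ∈ 𝔽_{2ⁿ}[x] of degree m (i.e. a₀ ≠ 0) with a₁ ≠ 0 has maximal differential uniformity, namely δ_{𝔽_{2ⁿ}}(f) = m−2. -/

import Mathlib

open Polynomial

/-- Membership in the set `𝓜` of odd positive integers `m` such that for all `ζ₁, ζ₂` in the
algebraic closure of `𝔽₂` with `ζ₁ ≠ 1` and `ζ₂ ≠ 1`, the conditions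
`ζ₁ ^ (m-1) = ζ₂ ^ (m-1) = ((1+ζ₁)/(1+ζ₂)) ^ (m-1) = 1` imply `ζ₁ = ζ₂` or `ζ₁ = ζ₂⁻¹`. -/
def InM (m : ℕ) : Prop :=
  Odd m ∧ 0 < m ∧
    ∀ ζ₁ ζ₂ : AlgebraicClosure (ZMod 2), ζ₁ ≠ 1 → ζ₂ ≠ 1 →
      ζ₁ ^ (m - 1) = 1 → ζ₂ ^ (m - 1) = 1 →
      ((1 + ζ₁) / (1 + ζ₂)) ^ (m - 1) = 1 →
      ζ₁ = ζ₂ ∨ ζ₁ = ζ₂⁻¹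

/-- The differential uniformity of a polynomial `f` over a field `F`: the maximum, over
`α ∈ F \ {0}` and `β ∈ F`, of the number of solutions `x ∈ F` of `f(x+α) - f(x) = β`. -/
noncomputable def diffUnif {F : Type*} [Field F] (f : F[X]) : ℕ :=
  sSup {k : ℕ | ∃ α : F, α ≠ 0 ∧ ∃ β : F,
    k = Nat.card {x : F // f.eval (x + α) - f.eval x = β}}

section Cover

variable {K B G ι : Type*} [Field K] [CommRing B] [Algebra K B] [Group G] [MulSemiringAction G B]

/-- The span of `1` and the elements `y i`; its powers filter the algebra generated by `y`. -/
def degOneSpan (K : Type*) {B ι : Type*} [Field K] [CommRing B] [Algebra K B] (y : ι → B) :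
    Submodule K B :=
  Submodule.span K (insert 1 (Set.range y))

/-- `B` is generated over `K` by the roots `y` of `E - T`, the group `G` acts on `B` with ring of
invariants `K[T]`, and `T` has degree `deg E` relative to the `y i`. -/
structure IsRootCover (G : Type*) {K B ι : Type*} [Field K] [CommRing B] [Algebra K B] [Group G]
    [MulSemiringAction G B] [Fintype ι] (E : K[X]) (T : B) (y : ι → B) : Prop where
  inj : Function.Injective y
  prod_eq : ∏ i, (X - C (y i)) = E.map (algebraMap K B) - C T
  adjoin_eq : Algebra.adjoin K (Set.range y) = ⊤
  invariants : ∀ b : B, (∀ g : G, g • b = b) → ∃ a : K[X], aeval T a = b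
  smul_T : ∀ g : G, g • T = T
  deg_le : ∀ (a : K[X]) (M : ℕ), aeval T a ∈ degOneSpan K y ^ M → Fintype.card ι * a.natDegree ≤ M

theorem one_mem_degOneSpan (y : ι → B) : (1 : B) ∈ degOneSpan K y :=
  Submodule.subset_span (Set.mem_insert _ _)

theorem mem_degOneSpan (y : ι → B) (i : ι) : y i ∈ degOneSpan K y :=
  Submodule.subset_span (Set.mem_insert_of_mem _ ⟨i, rfl⟩)

theorem degOneSpan_pow_mono (y : ι → B) : Monotone fun M : ℕ => degOneSpan K y ^ M := by
  have h : (1 : Submodule K B) ≤ degOneSpan K y := Submodule.one_le.2 (one_mem_degOneSpan y)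
  exact pow_right_mono₀ h

theorem pow_mem_degOneSpan {y : ι → B} {M : ℕ} {s : B} (hs : s ∈ degOneSpan K y ^ M) (P : ℕ) :
    s ^ P ∈ degOneSpan K y ^ (M * P) := by
  rw [pow_mul]
  exact Submodule.pow_mem_pow _ hs P

theorem mul_mem_degOneSpan {y : ι → B} {M N : ℕ} {s r : B} (hs : s ∈ degOneSpan K y ^ M)
    (hr : r ∈ degOneSpan K y ^ N) : s * r ∈ degOneSpan K y ^ (M + N) := by
  rw [pow_add]
  exact Submodule.mul_mem_mul hs hr

theorem algebraMap_mem_degOneSpan (y : ι → B) (M : ℕ) (c : K) :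
    algebraMap K B c ∈ degOneSpan K y ^ M := by
  refine degOneSpan_pow_mono y (Nat.zero_le M) ?_
  simp

theorem prod_mem_degOneSpan {κ : Type*} {y : ι → B} {M : ℕ} (s : Finset κ) {f : κ → B}
    (hf : ∀ k ∈ s, f k ∈ degOneSpan K y ^ M) : ∏ k ∈ s, f k ∈ degOneSpan K y ^ (s.card * M) := by
  classical
  induction s using Finset.induction_on with
  | empty => simpa using ⟨1, map_one _⟩
  | insert a s ha ih =>
    rw [Finset.prod_insert ha, Finset.card_insert_of_notMem ha, add_mul, one_mul, add_comm]
    exact mul_mem_degOneSpan (hf a (Finset.mem_insert_self a s))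
      (ih fun k hk => hf k (Finset.mem_insert_of_mem hk))

/-- A semilinear ring homomorphism permuting the generators preserves the filtration. -/
theorem map_mem_degOneSpan {y : ι → B} (f : B →+* B)
    (hK : ∀ c : K, ∃ c' : K, f (algebraMap K B c) = algebraMap K B c')
    (hy : ∀ i, ∃ j, f (y i) = y j) {M : ℕ} {s : B} (hs : s ∈ degOneSpan K y ^ M) :
    f s ∈ degOneSpan K y ^ M := by
  have h1 : ∀ s ∈ degOneSpan K y, f s ∈ degOneSpan K y := by
    intro s hs
    induction hs using Submodule.span_induction with
    | mem x hx =>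
      rcases hx with rfl | ⟨i, rfl⟩
      · simpa using one_mem_degOneSpan y
      · obtain ⟨j, hj⟩ := hy i
        rw [hj]; exact mem_degOneSpan y j
    | zero => simp
    | add a b _ _ ha hb => rw [map_add]; exact add_mem ha hb
    | smul c a _ ha =>
      obtain ⟨c', hc'⟩ := hK c
      rw [Algebra.smul_def, map_mul, hc', ← Algebra.smul_def]
      exact Submodule.smul_mem _ _ ha
  induction hs using Submodule.pow_induction_on_left' with
  | algebraMap r =>
    obtain ⟨c', hc'⟩ := hK r
    rw [hc']; exact algebraMap_mem_degOneSpan y 0 c'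
  | add a b i _ _ ha hb => rw [map_add]; exact add_mem ha hb
  | mem_mul m hm i x hx ih =>
    rw [map_mul, pow_succ']
    exact Submodule.mul_mem_mul (h1 m hm) ih

instance finite_degOneSpan [Finite ι] (y : ι → B) (M : ℕ) :
    Module.Finite K ↥(degOneSpan K y ^ M) := by
  rw [Module.Finite.iff_fg]
  refine Submodule.FG.pow (Submodule.fg_span ?_) M
  exact (Set.finite_range y).insert 1

end Cover

namespace IsRootCover

variable {K B G ι : Type*} [Field K] [CommRing B] [Algebra K B] [Group G]
  [MulSemiringAction G B] [Fintype ι] {E : K[X]} {T : B} {y : ι → B}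

section Basic

theorem aeval_y (h : IsRootCover G E T y) (i : ι) : aeval (y i) E = T := by
  have h1 := congrArg (eval (y i)) h.prod_eq
  rw [eval_prod, Finset.prod_eq_zero (Finset.mem_univ i) (by simp)] at h1
  rw [eval_sub, eval_C, eval_map_algebraMap] at h1
  exact (sub_eq_zero.1 h1.symm)

theorem exists_eq_y [IsDomain B] (h : IsRootCover G E T y) {b : B} (hb : aeval b E = T) :
    ∃ i, b = y i := by
  have h1 := congrArg (eval b) h.prod_eq
  rw [eval_prod, eval_sub, eval_C, eval_map_algebraMap, hb, sub_self,
    Finset.prod_eq_zero_iff] at h1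
  obtain ⟨i, -, hi⟩ := h1
  exact ⟨i, by simpa [sub_eq_zero] using hi⟩

theorem eq_zero_of_aeval_eq_zero [Nonempty ι] [Nontrivial B] (h : IsRootCover G E T y) {a : K[X]}
    (ha : aeval T a = 0) : a = 0 := by
  have h1 := h.deg_le a 0 (by rw [ha]; exact zero_mem _)
  have h2 : a.natDegree = 0 := by
    have := Fintype.card_pos (α := ι)
    rcases Nat.mul_eq_zero.1 (Nat.le_zero.1 h1) with h | h
    · omega
    · exact h
  rw [eq_C_of_natDegree_eq_zero h2] at ha ⊢
  rw [aeval_C] at ha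
  rw [(algebraMap K B).injective (ha.trans (map_zero _).symm), C_0]

theorem aeval_injective [Nonempty ι] [Nontrivial B] (h : IsRootCover G E T y) {a b : K[X]}
    (hab : aeval T a = aeval T b) : a = b := by
  rw [← sub_eq_zero]
  exact h.eq_zero_of_aeval_eq_zero (by rw [map_sub, hab, sub_self])

theorem smul_y [IsDomain B] [SMulCommClass G K B] (h : IsRootCover G E T y) (g : G) (i : ι) :
    ∃ j, g • y i = y j := by
  apply h.exists_eq_y
  have h1 := congrArg (MulSemiringAction.toAlgHom K B g) (h.aeval_y i)
  rw [← aeval_algHom_apply] at h1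
  simpa [h.smul_T g] using h1

theorem prod_map (h : IsRootCover G E T y) (χ : B →ₐ[K] K) :
    ∏ i, (X - C (χ (y i))) = E - C (χ T) := by
  have h1 := congrArg (Polynomial.map (χ : B →+* K)) h.prod_eq
  rw [Polynomial.map_prod, Polynomial.map_sub, Polynomial.map_map] at h1
  simpa using h1

theorem exists_map_eq (h : IsRootCover G E T y) (χ : B →ₐ[K] K) {r : K} (hr : eval r E = χ T) :
    ∃ i, χ (y i) = r := by
  have h1 := congrArg (eval r) (h.prod_map χ)
  rw [eval_prod, eval_sub, eval_C, hr, sub_self, Finset.prod_eq_zero_iff] at h1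
  obtain ⟨i, -, hi⟩ := h1
  exact ⟨i, by simpa [sub_eq_zero, eq_comm (a := r)] using hi⟩

theorem eval_map (h : IsRootCover G E T y) (χ : B →ₐ[K] K) (i : ι) : eval (χ (y i)) E = χ T := by
  rw [← h.aeval_y i, ← aeval_algHom_apply]; simp

theorem smul_mem [IsDomain B] [SMulCommClass G K B] (h : IsRootCover G E T y) (g : G) {M : ℕ}
    {s : B} (hs : s ∈ degOneSpan K y ^ M) : g • s ∈ degOneSpan K y ^ M :=
  map_mem_degOneSpan (MulSemiringAction.toRingHom G B g) (fun c => ⟨c, smul_algebraMap g c⟩)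
    (h.smul_y g) hs

/-- The norm of `s` is a polynomial in `T`. -/
theorem exists_norm [Fintype G] (h : IsRootCover G E T y) (s : B) :
    ∃ a : K[X], aeval T a = ∏ g : G, g • s := by
  apply h.invariants
  intro g
  rw [Finset.smul_prod']
  exact Fintype.prod_equiv (Equiv.mulLeft g) _ _ fun k => by simp [mul_smul]

theorem exists_trace [Fintype G] (h : IsRootCover G E T y) (s : B) :
    ∃ a : K[X], aeval T a = ∑ g : G, g • s := by
  apply h.invariants
  intro g
  rw [Finset.smul_sum]
  exact Fintype.sum_equiv (Equiv.mulLeft g) _ _ fun k => by simp [mul_smul]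

theorem natDegree_norm_le [IsDomain B] [SMulCommClass G K B] [Fintype G] (h : IsRootCover G E T y)
    {M : ℕ} {s : B} (hs : s ∈ degOneSpan K y ^ M) {a : K[X]} (ha : aeval T a = ∏ g : G, g • s) :
    Fintype.card ι * a.natDegree ≤ Fintype.card G * M := by
  apply h.deg_le
  rw [ha]
  exact prod_mem_degOneSpan Finset.univ fun g _ => h.smul_mem g hs

theorem norm_ne_zero [IsDomain B] [Fintype G] {s : B} (hs : s ≠ 0) : ∏ g : G, g • s ≠ 0 := by
  refine Finset.prod_ne_zero_iff.2 fun g _ => ?_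
  rwa [Ne, smul_eq_zero_iff_eq]

theorem finiteType (h : IsRootCover G E T y) : Algebra.FiniteType K B :=
  ⟨⟨(Set.finite_range y).toFinset, by simpa using h.adjoin_eq⟩⟩

end Basic

/-- The composition of a point with an element of the group. -/
def _root_.AlgHom.compSMul [SMulCommClass G K B] (χ : B →ₐ[K] K) (g : G) : B →ₐ[K] K :=
  χ.comp (MulSemiringAction.toAlgHom K B g)

theorem _root_.AlgHom.compSMul_apply [SMulCommClass G K B] (χ : B →ₐ[K] K) (g : G) (b : B) :
    χ.compSMul g b = χ (g • b) := rfl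

section Points

variable [SMulCommClass G K B]

theorem exists_point [Fintype G] [IsDomain B] [IsAlgClosed K] [Nonempty ι] (h : IsRootCover G E T y) (t : K) :
    ∃ χ : B →ₐ[K] K, χ T = t := by
  have hne : Ideal.span {T - algebraMap K B t} ≠ ⊤ := by
    rw [Ne, Ideal.span_singleton_eq_top]
    intro hu
    obtain ⟨b, hb⟩ := hu.exists_right_inv
    obtain ⟨a, ha⟩ := h.exists_norm (G := G) b
    have h1 : aeval T ((X - C t) ^ Fintype.card G * a) = aeval T (1 : K[X]) := by
      have h2 : (∏ g : G, g • (T - algebraMap K B t)) * ∏ g : G, g • b = 1 := by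
        rw [← Finset.prod_mul_distrib]
        exact Finset.prod_eq_one fun g _ => by rw [← smul_mul', hb, smul_one]
      rw [map_mul, map_pow, ha, map_one, ← h2]
      congr 1
      simp [smul_sub, h.smul_T]
    have h3 := congrArg (eval t) (h.aeval_injective h1)
    simp [Fintype.card_ne_zero] at h3
  obtain ⟨m, hm, hle⟩ := Ideal.exists_le_maximal _ hne
  have := h.finiteType
  let _ := Ideal.Quotient.field m
  have : Module.Finite K (B ⧸ m) := finite_of_finite_type_of_isJacobsonRing K (B ⧸ m)
  let e : K ≃ₐ[K] (B ⧸ m) := AlgEquiv.ofBijective (Algebra.ofId K (B ⧸ m))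
    (IsAlgClosed.algebraMap_bijective_of_isIntegral)
  refine ⟨(e.symm : (B ⧸ m) →ₐ[K] K).comp (Ideal.Quotient.mkₐ K m), ?_⟩
  have h4 : T - algebraMap K B t ∈ m := hle (Ideal.subset_span rfl)
  have h5 : Ideal.Quotient.mkₐ K m T = algebraMap K (B ⧸ m) t := by
    rw [← sub_eq_zero, ← (Ideal.Quotient.mkₐ K m).commutes, ← map_sub]
    exact Ideal.Quotient.eq_zero_iff_mem.2 h4
  rw [AlgHom.comp_apply, h5]
  exact e.symm.commutes t

theorem exists_compSMul_eq [Fintype G] (h : IsRootCover G E T y) {χ ψ : B →ₐ[K] K} (hT : χ T = ψ T) :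
    ∃ g : G, ψ = χ.compSMul g := by
  classical
  have hsub : ((RingHom.ker ψ : Ideal B) : Set B) ⊆
      ⋃ g ∈ ((Finset.univ : Finset G) : Set G), (RingHom.ker (χ.compSMul g) : Ideal B) := by
    intro b hb
    obtain ⟨a, ha⟩ := h.exists_norm (G := G) b
    have h1 : ψ (∏ g : G, g • b) = 0 := by
      rw [← Finset.prod_erase_mul _ _ (Finset.mem_univ (1 : G)), map_mul, one_smul,
        show ψ b = 0 from hb, mul_zero]
    have h2 : χ (∏ g : G, g • b) = 0 := by
      rw [← ha, ← aeval_algHom_apply, hT, aeval_algHom_apply, ha, h1]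
    rw [map_prod, Finset.prod_eq_zero_iff] at h2
    obtain ⟨g, hg, h3⟩ := h2
    simp only [Set.mem_iUnion]
    exact ⟨g, by simp, h3⟩
  rw [Ideal.subset_union_prime (1 : G) 1 (fun g _ _ _ => RingHom.ker_isPrime _)] at hsub
  obtain ⟨g, -, hg⟩ := hsub
  refine ⟨g, AlgHom.ext fun b => ?_⟩
  have h1 : b - algebraMap K B (ψ b) ∈ RingHom.ker ψ := by simp [RingHom.mem_ker]
  have h2 : χ.compSMul g (b - algebraMap K B (ψ b)) = 0 := hg h1
  rw [map_sub, AlgHom.commutes, sub_eq_zero] at h2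
  exact h2.symm

theorem compSMul_injective [IsDomain B] [FaithfulSMul G B] (h : IsRootCover G E T y) {χ : B →ₐ[K] K}
    (hχ : Function.Injective fun i => χ (y i)) :
    Function.Injective fun g : G => χ.compSMul g := by
  intro g g' hgg
  have key : ∀ i, g • y i = g' • y i := by
    intro i
    obtain ⟨j, hj⟩ := h.smul_y g i
    obtain ⟨j', hj'⟩ := h.smul_y g' i
    have h1 := congrArg (fun φ : B →ₐ[K] K => φ (y i)) hgg
    simp only [AlgHom.compSMul_apply, hj, hj'] at h1
    rw [hj, hj', hχ h1]
  apply FaithfulSMul.eq_of_smul_eq_smul (α := B)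
  intro b
  have h2 : MulSemiringAction.toAlgHom K B g = MulSemiringAction.toAlgHom K B g' := by
    apply AlgHom.ext_of_adjoin_eq_top h.adjoin_eq
    rintro _ ⟨i, rfl⟩
    exact key i
  exact congrArg (fun φ : B →ₐ[K] B => φ b) h2

end Points

end IsRootCover

namespace IsRootCover

variable {K B G ι : Type*} [Field K] [CommRing B] [Algebra K B] [Group G]
  [MulSemiringAction G B] [Fintype ι] {E : K[X]} {T : B} {y : ι → B}

/-- At a point where the `y i` take distinct values, `T - χ T` is a uniformizer. -/
theorem exists_mul_sub_mem (h : IsRootCover G E T y) {χ : B →ₐ[K] K}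
    (hχ : Function.Injective fun i => χ (y i)) :
    ∃ w : B, χ w ≠ 0 ∧ ∀ b ∈ RingHom.ker χ, w * b ∈ Ideal.span {T - algebraMap K B (χ T)} := by
  classical
  let w : ι → B := fun i => ∏ j ∈ Finset.univ.erase i, (y i - algebraMap K B (χ (y j)))
  have hw : ∀ i, w i * (y i - algebraMap K B (χ (y i))) = T - algebraMap K B (χ T) := by
    intro i
    have h1 := congrArg (aeval (y i)) (h.prod_map χ)
    simp only [map_prod, map_sub, aeval_X, aeval_C, h.aeval_y] at h1
    rw [← h1, Finset.prod_erase_mul _ _ (Finset.mem_univ i)]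
  refine ⟨∏ i, w i, ?_, ?_⟩
  · simp only [w, map_prod, Finset.prod_ne_zero_iff, map_sub, AlgHom.commutes, sub_ne_zero]
    intro i _ j hj
    exact fun e => (Finset.ne_of_mem_erase hj) (hχ e).symm
  · have key : ∀ b : B, (∏ i, w i) * (b - algebraMap K B (χ b)) ∈
        Ideal.span {T - algebraMap K B (χ T)} := by
      intro b
      have hb : b ∈ Algebra.adjoin K (Set.range y) := by rw [h.adjoin_eq]; trivial
      induction hb using Algebra.adjoin_induction with
      | mem x hx =>
        obtain ⟨i, rfl⟩ := hx
        rw [← Finset.prod_erase_mul _ _ (Finset.mem_univ i), mul_assoc, hw]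
        exact Ideal.mul_mem_left _ _ (Ideal.subset_span rfl)
      | algebraMap r => simp
      | add a b _ _ ha hb =>
        convert add_mem ha hb using 1
        rw [map_add, map_add]; ring
      | mul a b _ _ ha hb =>
        convert add_mem (Ideal.mul_mem_left _ a hb)
          (Ideal.mul_mem_left _ (algebraMap K B (χ b)) ha) using 1
        rw [map_mul, map_mul]; ring
    intro b hb
    have := key b
    rwa [show χ b = 0 from hb, map_zero, sub_zero] at this

theorem le_rootMultiplicity [IsDomain B] [Nonempty ι] (h : IsRootCover G E T y) {χ : B →ₐ[K] K}
    (hχ : Function.Injective fun i => χ (y i)) {a : K[X]} (ha : a ≠ 0) {r : ℕ}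
    (har : aeval T a ∈ RingHom.ker χ ^ r) : r ≤ a.rootMultiplicity (χ T) := by
  obtain ⟨w, hw, hwk⟩ := h.exists_mul_sub_mem hχ
  by_contra! hlt
  have h1 : w ^ r * aeval T a ∈ Ideal.span {(T - algebraMap K B (χ T)) ^ r} := by
    have h2 : Ideal.span {w} * RingHom.ker χ ≤ Ideal.span {T - algebraMap K B (χ T)} := by
      rw [Ideal.span_singleton_mul_le_iff]; exact hwk
    have h3 := pow_le_pow_left' h2 r
    rw [mul_pow, Ideal.span_singleton_pow, Ideal.span_singleton_pow] at h3
    exact h3 (Ideal.mul_mem_mul (Ideal.subset_span rfl) har)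
  obtain ⟨b, hb⟩ := Ideal.mem_span_singleton'.1 h1
  obtain ⟨c, hc, hnd⟩ := exists_eq_pow_rootMultiplicity_mul_and_not_dvd a ha (χ T)
  set j := a.rootMultiplicity (χ T)
  obtain ⟨i, rfl⟩ := Nat.exists_eq_add_of_lt hlt
  have hT : T - algebraMap K B (χ T) ≠ 0 := by
    intro h0
    have : (X - C (χ T) : K[X]) = 0 := h.eq_zero_of_aeval_eq_zero (by simpa using h0)
    exact X_sub_C_ne_zero _ this
  have h4 : (T - algebraMap K B (χ T)) ^ j * (b * (T - algebraMap K B (χ T)) ^ (i + 1)) =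
      (T - algebraMap K B (χ T)) ^ j * (w ^ (j + i + 1) * aeval T c) := by
    have : aeval T a = (T - algebraMap K B (χ T)) ^ j * aeval T c := by
      conv_lhs => rw [hc]
      simp
    rw [this] at hb
    linear_combination hb
  have h5 := congrArg χ (mul_left_cancel₀ (pow_ne_zero _ hT) h4)
  have h6 : eval (χ T) c = 0 := by
    have h7 : χ (aeval T c) = eval (χ T) c := by
      rw [← aeval_algHom_apply]; simp
    simpa [hw, h7] using h5
  exact hnd (dvd_iff_isRoot.2 h6)

variable [IsDomain B] [SMulCommClass G K B] [Fintype G] [Nonempty ι]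

/-- An element of degree at most `M` has at most `|G| M / |ι|` zeros. -/
theorem card_zeros_le (h : IsRootCover G E T y) {M : ℕ} {s : B}
    (hs : s ∈ degOneSpan K y ^ M) (hs0 : s ≠ 0) (Z : Finset (B →ₐ[K] K))
    (hZ : ∀ χ ∈ Z, Function.Injective fun i => χ (y i)) (hZs : ∀ χ ∈ Z, χ s = 0) :
    Fintype.card ι * Z.card ≤ Fintype.card G * M := by
  classical
  obtain ⟨a, ha⟩ := h.exists_norm (G := G) s
  have ha0 : a ≠ 0 := by
    rintro rfl
    exact norm_ne_zero (G := G) hs0 (by rw [← ha, map_zero])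
  refine le_trans (Nat.mul_le_mul_left _ ?_) (h.natDegree_norm_le hs ha)
  have hfib : ∀ t : K, (Z.filter fun χ => χ T = t).card ≤ a.roots.count t := by
    intro t
    rcases (Z.filter fun χ => χ T = t).eq_empty_or_nonempty with he | ⟨χ, hχ⟩
    · simp [he]
    rw [Finset.mem_filter] at hχ
    obtain ⟨hχZ, rfl⟩ := hχ
    have hcard : (Z.filter fun ψ => ψ T = χ T).card ≤
        ((Finset.univ : Finset G).filter fun g => χ (g • s) = 0).card := by
      refine le_trans (Finset.card_le_card (t := ((Finset.univ : Finset G).filter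
        fun g => χ (g • s) = 0).image χ.compSMul) ?_) Finset.card_image_le
      intro ψ hψ
      rw [Finset.mem_filter] at hψ
      obtain ⟨g, hg⟩ := h.exists_compSMul_eq hψ.2.symm
      refine Finset.mem_image.2 ⟨g, ?_, hg.symm⟩
      rw [Finset.mem_filter, ← AlgHom.compSMul_apply, ← hg]
      exact ⟨Finset.mem_univ _, hZs ψ hψ.1⟩
    refine hcard.trans ?_
    rw [count_roots]
    apply h.le_rootMultiplicity (hZ χ hχZ) ha0
    rw [ha, ← Finset.prod_filter_mul_prod_filter_not Finset.univ fun g => χ (g • s) = 0]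
    apply Ideal.mul_mem_right
    rw [← Finset.prod_const]
    exact Ideal.prod_mem_prod fun g hg => (Finset.mem_filter.1 hg).2
  calc Z.card = ∑ t ∈ Z.image fun χ => χ T, (Z.filter fun χ => χ T = t).card :=
        Finset.card_eq_sum_card_image _ _
    _ ≤ ∑ t ∈ Z.image fun χ => χ T, a.roots.count t := Finset.sum_le_sum fun t _ => hfib t
    _ ≤ Multiset.card a.roots := by
        rw [← Multiset.sum_count_eq_card (s := Z.image (fun χ => χ T) ∪ a.roots.toFinset)
          (fun t ht => Finset.mem_union_right _ (Multiset.mem_toFinset.2 ht))]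
        exact Finset.sum_le_sum_of_subset Finset.subset_union_left
    _ ≤ a.natDegree := card_roots' a

/-- An element vanishing to high order at one point is zero. -/
theorem eq_zero_of_mem_ker_pow (h : IsRootCover G E T y) {M Q : ℕ} {s : B}
    (hs : s ∈ degOneSpan K y ^ M) {χ : B →ₐ[K] K} (hχ : Function.Injective fun i => χ (y i))
    (hsQ : s ∈ RingHom.ker χ ^ Q) (hlt : Fintype.card G * M < Fintype.card ι * Q) : s = 0 := by
  classical
  by_contra hs0
  obtain ⟨a, ha⟩ := h.exists_norm (G := G) s
  have ha0 : a ≠ 0 := by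
    rintro rfl
    exact norm_ne_zero (G := G) hs0 (by rw [← ha, map_zero])
  have h1 : Q ≤ a.natDegree := by
    refine le_trans (h.le_rootMultiplicity hχ ha0 ?_) (by rw [← count_roots]; exact (Multiset.count_le_card _ _).trans (card_roots' a))
    rw [ha, ← Finset.mul_prod_erase _ _ (Finset.mem_univ (1 : G)), one_smul]
    exact Ideal.mul_mem_right _ _ hsQ
  have h2 := h.natDegree_norm_le hs ha
  have h3 := Nat.mul_le_mul_left (Fintype.card ι) h1
  omega

end IsRootCover

namespace IsRootCover

variable {K B G ι : Type*} [Field K] [CommRing B] [Algebra K B] [Group G]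
  [MulSemiringAction G B] [Fintype ι] {E : K[X]} {T : B} {y : ι → B}

theorem natDegree_eq [Nontrivial B] (h : IsRootCover G E T y) : E.natDegree = Fintype.card ι := by
  have h1 := congrArg natDegree h.prod_eq
  rw [natDegree_sub_C, natDegree_map_eq_of_injective (algebraMap K B).injective,
    natDegree_prod_of_monic _ _ fun i _ => monic_X_sub_C _] at h1
  simpa using h1.symm

/-- If the value of `T` is not critical then the `y i` take distinct values. -/
theorem injective_of_notMem [DecidableEq K] (h : IsRootCover G E T y) (hE : derivative E ≠ 0)
    {χ : B →ₐ[K] K}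
    (hχ : χ T ∉ (derivative E).roots.toFinset.image fun r => eval r E) :
    Function.Injective fun i => χ (y i) := by
  classical
  intro i j hij
  by_contra hne
  apply hχ
  refine Finset.mem_image.2 ⟨χ (y i), ?_, h.eval_map χ i⟩
  rw [Multiset.mem_toFinset, mem_roots hE]
  have h1 : (X - C (χ (y i))) ^ 2 ∣ E - C (χ T) := by
    rw [← h.prod_map χ, ← Finset.mul_prod_erase _ _ (Finset.mem_univ i),
      ← Finset.mul_prod_erase _ _ (Finset.mem_erase.2 ⟨Ne.symm hne, Finset.mem_univ j⟩),
      sq, ← mul_assoc]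
    have : χ (y i) = χ (y j) := hij
    rw [← this]
    exact Dvd.intro _ rfl
  obtain ⟨c, hc⟩ := h1
  have h2 := congrArg (fun p => eval (χ (y i)) (derivative p)) hc
  simpa [derivative_mul, derivative_pow] using h2

variable [IsDomain B] [SMulCommClass G K B] [Fintype G] [Nonempty ι]

theorem exists_points [IsAlgClosed K] (h : IsRootCover G E T y) (hE : derivative E ≠ 0) (N : ℕ) :
    ∃ Z : Finset (B →ₐ[K] K), Z.card = N ∧ ∀ χ ∈ Z, Function.Injective fun i => χ (y i) := by
  classical
  obtain ⟨Z, hZ, hN⟩ := (((derivative E).roots.toFinset.image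
    fun r => eval r E).finite_toSet.infinite_compl).exists_subset_card_eq N
  choose p hp using h.exists_point
  refine ⟨Z.image p, ?_, ?_⟩
  · rw [Finset.card_image_of_injective, hN]
    intro a b hab
    rw [← hp a, ← hp b, hab]
  · intro χ hχ
    obtain ⟨t, ht, rfl⟩ := Finset.mem_image.1 hχ
    apply h.injective_of_notMem hE
    rw [hp]
    exact hZ ht

theorem eq_zero_of_forall_point [IsAlgClosed K] (h : IsRootCover G E T y) (hE : derivative E ≠ 0)
    {M : ℕ} {s : B} (hs : s ∈ degOneSpan K y ^ M)
    (h0 : ∀ χ : B →ₐ[K] K, (Function.Injective fun i => χ (y i)) → χ s = 0) : s = 0 := by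
  by_contra hne
  obtain ⟨Z, hZ, hZi⟩ := h.exists_points hE (Fintype.card G * M + 1)
  have h1 := h.card_zeros_le hs hne Z hZi fun χ hχ => h0 χ (hZi χ hχ)
  have h2 : 1 ≤ Fintype.card ι := Fintype.card_pos
  rw [hZ] at h1
  nlinarith

theorem finrank_le [IsAlgClosed K] (h : IsRootCover G E T y) (hE : derivative E ≠ 0) {M N : ℕ}
    (hlt : Fintype.card G * M < Fintype.card ι * N) :
    Module.finrank K ↥(degOneSpan K y ^ M) ≤ N := by
  obtain ⟨Z, rfl, hZi⟩ := h.exists_points hE N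
  let φ : ↥(degOneSpan K y ^ M) →ₗ[K] (Z → K) :=
    LinearMap.pi fun χ => (χ.1.toLinearMap).comp (Submodule.subtype _)
  have hφ : Function.Injective φ := by
    rw [← LinearMap.ker_eq_bot, LinearMap.ker_eq_bot']
    intro s hs
    by_contra hne
    have h1 := h.card_zeros_le s.2 (fun e => hne (Subtype.ext e)) Z hZi
      fun χ hχ => congrFun hs ⟨χ, hχ⟩
    omega
  simpa using LinearMap.finrank_le_finrank_of_injective hφ

/-- Elements of small degree are independent over the `2 ^ ν`-th powers of elements which are
linearly independent over `K`. -/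
theorem eq_zero_of_sum_mul_pow_eq_zero [IsAlgClosed K] [CharP K 2] (h : IsRootCover G E T y)
    (hE : derivative E ≠ 0) {κ : Type*} [Fintype κ] {M ℓ ν : ℕ} {w s : κ → B}
    (hw : ∀ i, w i ∈ degOneSpan K y ^ M) (hli : LinearIndependent K w)
    (hs : ∀ i, s i ∈ degOneSpan K y ^ ℓ)
    (hlt : Fintype.card G * ℓ < Fintype.card ι * 2 ^ ν)
    (h0 : ∑ i, s i * w i ^ 2 ^ ν = 0) (i : κ) : s i = 0 := by
  have : CharP B 2 := charP_of_injective_algebraMap (algebraMap K B).injective 2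
  have key : ∀ χ : B →ₐ[K] K, (Function.Injective fun i => χ (y i)) →
      ∑ i, (χ (w i)) ^ 2 ^ ν • s i = 0 := by
    intro χ hχ
    refine h.eq_zero_of_mem_ker_pow (Submodule.sum_mem _ fun i _ => Submodule.smul_mem _ _ (hs i))
      hχ ?_ hlt
    have h1 : ∑ i, (χ (w i)) ^ 2 ^ ν • s i =
        ∑ i, s i * (algebraMap K B (χ (w i)) - w i) ^ 2 ^ ν := by
      have h2 : ∀ i, s i * (algebraMap K B (χ (w i)) - w i) ^ 2 ^ ν =
          (χ (w i)) ^ 2 ^ ν • s i - s i * w i ^ 2 ^ ν := by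
        intro i
        rw [sub_pow_char_pow, Algebra.smul_def, map_pow]
        ring
      rw [Finset.sum_congr rfl fun i _ => h2 i, Finset.sum_sub_distrib, h0, sub_zero]
    rw [h1]
    refine Submodule.sum_mem _ fun i _ => Ideal.mul_mem_left _ _ (Ideal.pow_mem_pow ?_ _)
    simp [RingHom.mem_ker]
  by_contra hne
  obtain ⟨lam, hlam⟩ : ∃ lam : Module.Dual K B, lam (s i) ≠ 0 := by
    by_contra! hall
    exact hne ((Module.forall_dual_apply_eq_zero_iff K _).1 hall)
  choose ρ hρ using fun j => IsAlgClosed.exists_pow_nat_eq (lam (s j)) (n := 2 ^ ν) (by positivity)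
  have h2 : ∑ j, ρ j • w j = 0 := by
    refine h.eq_zero_of_forall_point hE
      (Submodule.sum_mem _ fun j _ => Submodule.smul_mem _ _ (hw j)) fun χ hχ => ?_
    have h3 := congrArg lam (key χ hχ)
    rw [map_sum, map_zero] at h3
    have h4 : (∑ j, ρ j * χ (w j)) ^ 2 ^ ν = 0 := by
      rw [sum_pow_char_pow, ← h3]
      refine Finset.sum_congr rfl fun j _ => ?_
      rw [mul_pow, hρ, map_smul, smul_eq_mul, mul_comm]
    simpa using (pow_eq_zero_iff (by positivity)).1 h4
  have h5 := Fintype.linearIndependent_iff.1 hli ρ h2 i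
  apply hlam
  rw [← hρ, h5, zero_pow (by positivity)]

/-- A Stepanov-type bound for the number of points on which a twisted Frobenius acts as a given
element of the group. -/
theorem card_twisted_le [IsAlgClosed K] [CharP K 2] (h : IsRootCover G E T y)
    (hE : derivative E ≠ 0) {μ ν ℓ M : ℕ}
    {τ : B →+* B} (hτ : Function.Injective τ) {σ : K → K}
    (hσ : ∀ c, τ (algebraMap K B c) = algebraMap K B (σ c)) (hσq : ∀ c, σ c ^ 2 ^ (μ + ν) = c)
    (hτy : ∀ i, τ (y i) = y i) (hlt : Fintype.card G * ℓ < Fintype.card ι * 2 ^ ν)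
    (hdim : Module.finrank K ↥(degOneSpan K y ^ (ℓ * 2 ^ μ + M)) <
      Module.finrank K ↥(degOneSpan K y ^ M) * Module.finrank K ↥(degOneSpan K y ^ ℓ))
    (g : G) (S : Finset (B →ₐ[K] K)) (hS : ∀ χ ∈ S, Function.Injective fun i => χ (y i))
    (hSg : ∀ χ ∈ S, ∀ b, χ (τ b) ^ 2 ^ (μ + ν) = χ (g • b)) :
    Fintype.card ι * S.card ≤ Fintype.card G * (ℓ + M * 2 ^ ν) := by
  have : CharP B 2 := charP_of_injective_algebraMap (algebraMap K B).injective 2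
  let f := Module.finBasis K ↥(degOneSpan K y ^ M)
  let b := Module.finBasis K ↥(degOneSpan K y ^ ℓ)
  let φ : (Fin (Module.finrank K ↥(degOneSpan K y ^ M)) ×
      Fin (Module.finrank K ↥(degOneSpan K y ^ ℓ)) → K) →ₗ[K]
      ↥(degOneSpan K y ^ (ℓ * 2 ^ μ + M)) :=
    Fintype.linearCombination K fun p => ⟨(b p.2 : B) ^ 2 ^ μ * (f p.1 : B),
      mul_mem_degOneSpan (pow_mem_degOneSpan (b p.2).2 _) (f p.1).2⟩
  obtain ⟨c, hc, hc0⟩ := (Submodule.ne_bot_iff _).1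
    (LinearMap.ker_ne_bot_of_finrank_lt (f := φ) (by simpa using hdim))
  have hc1 : ∑ i, ∑ j, c (i, j) • ((b j : B) ^ 2 ^ μ * (f i : B)) = 0 := by
    have h1 := congrArg Subtype.val (LinearMap.mem_ker.1 hc)
    rw [Fintype.linearCombination_apply, Submodule.coe_sum, Fintype.sum_prod_type] at h1
    simpa using h1
  choose d hd using fun p => IsAlgClosed.exists_pow_nat_eq (c p) (n := 2 ^ μ) (by positivity)
  let s : Fin (Module.finrank K ↥(degOneSpan K y ^ M)) → B := fun i => ∑ j, d (i, j) • (b j : B)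
  have hs : ∀ i, s i ∈ degOneSpan K y ^ ℓ := fun i =>
    Submodule.sum_mem _ fun j _ => Submodule.smul_mem _ _ (b j).2
  let w : Fin (Module.finrank K ↥(degOneSpan K y ^ M)) → B := fun i => τ (g⁻¹ • (f i : B))
  have hw : ∀ i, w i ∈ degOneSpan K y ^ M := fun i =>
    map_mem_degOneSpan τ (fun c => ⟨σ c, hσ c⟩) (fun i => ⟨i, hτy i⟩) (h.smul_mem g⁻¹ (f i).2)
  have hli : LinearIndependent K w := by
    rw [Fintype.linearIndependent_iff]
    intro a ha i
    have hσ' : ∀ c : K, σ (c ^ 2 ^ (μ + ν)) = c := by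
      intro c
      apply (algebraMap K B).injective
      rw [← hσ, map_pow, map_pow, hσ, ← map_pow, hσq]
    have h1 : τ (g⁻¹ • ∑ i, a i ^ 2 ^ (μ + ν) • (f i : B)) = 0 := by
      rw [← ha, Finset.smul_sum, map_sum]
      refine Finset.sum_congr rfl fun i _ => ?_
      rw [smul_comm, Algebra.smul_def, map_mul, hσ, hσ', ← Algebra.smul_def]
    have h2 : ∑ i, a i ^ 2 ^ (μ + ν) • f i = 0 := by
      apply Subtype.ext
      have h3 := hτ (h1.trans (map_zero τ).symm)
      rw [smul_eq_zero_iff_eq] at h3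
      simpa using h3
    exact (pow_eq_zero_iff (by positivity)).1 (Fintype.linearIndependent_iff.1 f.linearIndependent _ h2 i)
  have hne : ∑ i, s i * w i ^ 2 ^ ν ≠ 0 := by
    intro h0
    apply hc0
    ext ⟨i, j⟩
    have h1 : ∑ j, d (i, j) • b j = 0 := by
      apply Subtype.ext
      simpa using h.eq_zero_of_sum_mul_pow_eq_zero hE hw hli hs hlt h0 i
    rw [← hd, Fintype.linearIndependent_iff.1 b.linearIndependent _ h1 j]
    simp
  refine h.card_zeros_le (Submodule.sum_mem _ fun i _ =>
    mul_mem_degOneSpan (hs i) (pow_mem_degOneSpan (hw i) _)) hne S hS fun χ hχ => ?_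
  rw [← pow_eq_zero_iff (n := 2 ^ μ) (by positivity), map_sum, sum_pow_char_pow,
    ← map_zero χ, ← hc1, map_sum]
  refine Finset.sum_congr rfl fun i _ => ?_
  have h1 : χ (w i) ^ 2 ^ (μ + ν) = χ (f i) := by
    rw [hSg χ hχ, smul_inv_smul]
  rw [map_mul, mul_pow, map_pow, ← pow_mul, ← pow_add, add_comm ν, h1, map_sum, map_sum,
    sum_pow_char_pow, Finset.sum_mul]
  refine Finset.sum_congr rfl fun j _ => ?_
  simp only [map_smul, smul_eq_mul, mul_pow, hd, map_mul, map_pow]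
  ring

end IsRootCover

/-- The choice of degrees in the auxiliary construction of Stepanov's method. -/
theorem exists_stepanov_degrees {κ D P Q : ℕ} (hκ : 0 < κ) (hPQ : P ≤ Q)
    (hP : 2 * (κ * D) + 3 * κ + 2 + κ * (κ * D + 3) + (κ * D + 3 * κ) * (κ * D) ≤ P) :
    ∃ ℓ M : ℕ, κ * ℓ < Q ∧ κ * (ℓ * P + M) + 1 < κ * (M - D) * (κ * (ℓ - D)) ∧
      κ * (ℓ + M * Q) ≤ Q * (P + (1 + 2 * (κ * D) + 3 * κ)) := by
  have hz1 : κ * ((P - 1) / κ) ≤ P - 1 := Nat.mul_div_le _ _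
  have hz2 : P - 1 < κ * ((P - 1) / κ + 1) := Nat.lt_mul_div_succ _ hκ
  have hx1 : κ * (P / κ) ≤ P := Nat.mul_div_le _ _
  have hx2 : P < κ * (P / κ + 1) := Nat.lt_mul_div_succ _ hκ
  generalize (P - 1) / κ = ℓ at hz1 hz2
  generalize P / κ = v at hx1 hx2
  have hDℓ : D ≤ ℓ := by
    by_contra! hlt
    have : κ * (ℓ + 1) ≤ κ * D := Nat.mul_le_mul_left _ hlt
    omega
  obtain ⟨u, rfl⟩ := Nat.exists_eq_add_of_le hDℓ
  have hP2 : 2 ≤ P := le_trans (by omega) hP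
  refine ⟨D + u, D + (v + (D + 3)), by omega, ?_, ?_⟩
  · rw [Nat.add_sub_cancel_left, Nat.add_sub_cancel_left]
    have e1 : κ * (v + (D + 3)) = κ * v + κ * D + 3 * κ := by ring
    have e2 : κ * ((D + u) * P + (D + (v + (D + 3)))) =
      (κ * (D + u)) * P + (κ * v + 2 * (κ * D) + 3 * κ) := by ring
    rw [e2, e1]
    have e3 : κ * (D + u) = κ * D + κ * u := by ring
    have e4 : κ * (D + u + 1) = κ * D + κ * u + κ := by ring
    have e5 : κ * (v + 1) = κ * v + κ := by ring
    rw [e3] at hz1 ⊢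
    rw [e4] at hz2
    rw [e5] at hx2
    generalize κ * D = a at *
    generalize κ * u = z at *
    generalize κ * v = x at *
    zify at *
    have hz1' : (a : ℤ) + z + 1 ≤ P := by omega
    have hz2' : (P : ℤ) ≤ a + z + κ := by omega
    nlinarith
  · have : κ * (D + u + (D + (v + (D + 3))) * Q) =
      κ * (D + u) + (κ * v + 2 * (κ * D) + 3 * κ) * Q := by ring
    rw [this]
    have h1 : κ * (D + u) ≤ Q := by omega
    have h2 : (κ * v + 2 * (κ * D) + 3 * κ) * Q ≤ (P + 2 * (κ * D) + 3 * κ) * Q := by gcongr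
    linarith

theorem false_of_count_le {κ D P Q e r : ℕ} (hD : 0 < D) (hκD : κ ≤ D) (heD : e ≤ D) (hQ : 1 ≤ Q)
    (hP : 10 * (D + 2) ^ 4 ≤ P) (hr : P * Q ≤ r + e)
    (hle : r * D ≤ (D - 1) * (Q * (P + (1 + 2 * (κ * D) + 3 * κ)))) : False := by
  obtain ⟨d, rfl⟩ : ∃ d, D = d + 1 := ⟨D - 1, by omega⟩
  rw [Nat.add_sub_cancel] at hle
  have h1 : P * Q * (d + 1) ≤ r * (d + 1) + e * (d + 1) := by
    rw [← add_mul]; exact Nat.mul_le_mul_right _ hr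
  have h2 : κ * (d + 1) ≤ (d + 1) * (d + 1) := Nat.mul_le_mul_right _ hκD
  have h3 : P * Q ≤ ((d + 1) * (1 + 2 * ((d + 1) * (d + 1)) + 3 * (d + 1)) +
      (d + 1) * (d + 1)) * Q := by
    have h4 : P * Q ≤ d * Q * (1 + 2 * (κ * (d + 1)) + 3 * κ) + e * (d + 1) := by linarith
    refine h4.trans ?_
    rw [add_mul]
    refine Nat.add_le_add ?_ ?_
    · rw [mul_right_comm]; gcongr; omega
    · exact (Nat.mul_le_mul_right _ heD).trans (Nat.le_mul_of_pos_right _ hQ)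
  have h4 := Nat.le_of_mul_le_mul_right h3 hQ
  have := Nat.zero_le (d ^ 3)
  have := Nat.zero_le (d ^ 4)
  have := Nat.zero_le (d ^ 2)
  ring_nf at *
  omega

namespace IsRootCover

variable {K B G ι : Type*} [Field K] [CommRing B] [Algebra K B] [Group G]
  [MulSemiringAction G B] [Fintype ι] {E : K[X]} {T : B} {y : ι → B}
  [SMulCommClass G K B] [Fintype G]

/-- Every point over a `2 ^ n`-rational value of `T` is twisted by some group element. -/
theorem exists_twist [CharP K 2] (h : IsRootCover G E T y) {n : ℕ}
    {τ : B →+* B} {σ : K → K}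
    (hσ : ∀ c, τ (algebraMap K B c) = algebraMap K B (σ c)) (hσq : ∀ c, σ c ^ 2 ^ n = c)
    (hτT : τ T = T) {χ : B →ₐ[K] K} (hχ : χ T ^ 2 ^ n = χ T) :
    ∃ g : G, ∀ b, χ (τ b) ^ 2 ^ n = χ (g • b) := by
  let ψ : B →ₐ[K] K :=
    { toRingHom := (iterateFrobenius K 2 n).comp ((χ : B →+* K).comp τ)
      commutes' := fun c => by simp [iterateFrobenius_def, hσ, hσq] }
  have hψ : ∀ b, ψ b = χ (τ b) ^ 2 ^ n := fun b => rfl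
  obtain ⟨g, hg⟩ := h.exists_compSMul_eq (χ := χ) (ψ := ψ) (by rw [hψ, hτT, hχ])
  exact ⟨g, fun b => by rw [← hψ, hg, AlgHom.compSMul_apply]⟩

/-- For large `n`, if the constant field of the cover is the field with `2 ^ n` elements, then
some value of `T` in that field has all its preimages under `E` in that field. -/
theorem exists_rational_point [IsDomain B] [Nonempty ι] [IsAlgClosed K] [CharP K 2] [FaithfulSMul G B]
    (h : IsRootCover G E T y) (hE : derivative E ≠ 0)
    {κ : ℕ} (hκ : Fintype.card G = Fintype.card ι * κ)
    (hdim : ∀ M, κ * (M - Fintype.card G) ≤ Module.finrank K ↥(degOneSpan K y ^ M))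
    {n : ℕ} {τ : B →+* B} (hτ : Function.Injective τ) {σ : K → K}
    (hσ : ∀ c, τ (algebraMap K B c) = algebraMap K B (σ c)) (hσq : ∀ c, σ c ^ 2 ^ n = c)
    (hτy : ∀ i, τ (y i) = y i) (hτT : τ T = T)
    (R : Finset K) (hR : R.card = 2 ^ n) (hRn : ∀ t ∈ R, t ^ 2 ^ n = t)
    (hn : 10 * (Fintype.card G + 2) ^ 4 ≤ 2 ^ (n / 2)) :
    ∃ χ : B →ₐ[K] K, (Function.Injective fun i => χ (y i)) ∧ χ T ^ 2 ^ n = χ T ∧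
      ∀ i, χ (y i) ^ 2 ^ n = χ (y i) := by
  classical
  by_contra! hcon
  set D := Fintype.card G with hD
  set e := Fintype.card ι with he
  have hD0 : 0 < D := Fintype.card_pos
  have he0 : 0 < e := Fintype.card_pos
  have hκ0 : 0 < κ := by
    rcases Nat.eq_zero_or_pos κ with h0 | h0
    · rw [h0, mul_zero] at hκ; omega
    · exact h0
  have hκD : κ ≤ D := by rw [hκ]; exact Nat.le_mul_of_pos_left _ he0
  have heD : e ≤ D := by rw [hκ]; exact Nat.le_mul_of_pos_right _ hκ0
  set P := 2 ^ (n / 2) with hP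
  set Q := 2 ^ (n - n / 2) with hQ
  have hPQ : P ≤ Q := Nat.pow_le_pow_right (by norm_num) (by omega)
  have hn2 : n / 2 + (n - n / 2) = n := by omega
  have hq : 2 ^ n = P * Q := by rw [hP, hQ, ← pow_add, hn2]
  have hκD2 : κ * D ≤ D * D := Nat.mul_le_mul_right _ hκD
  obtain ⟨ℓ, M, h1, h2, h3⟩ := exists_stepanov_degrees (κ := κ) (D := D) (P := P) (Q := Q) hκ0 hPQ (by
    refine le_trans ?_ hn
    calc _ ≤ 2 * (D * D) + 3 * D + 2 + D * (D * D + 3) + (D * D + 3 * D) * (D * D) := by gcongr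
      _ ≤ _ := by
        have := Nat.zero_le (D ^ 3); have := Nat.zero_le (D ^ 4); have := Nat.zero_le (D ^ 2)
        ring_nf; omega)
  -- the fibres over rational values of `T` which are not critical
  let bad : Finset K := (derivative E).roots.toFinset.image fun r => eval r E
  have hbad : bad.card ≤ e := by
    refine Finset.card_image_le.trans ((Multiset.toFinset_card_le _).trans
      ((card_roots' _).trans ((natDegree_derivative_le E).trans ?_)))
    rw [h.natDegree_eq]; omega
  choose p hp using h.exists_point
  have hpi : ∀ t ∈ R \ bad, Function.Injective fun i => p t (y i) := fun t ht =>
    h.injective_of_notMem hE (by rw [hp]; exact (Finset.mem_sdiff.1 ht).2)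
  let A : Finset (K × G) := (R \ bad) ×ˢ Finset.univ
  have hinj : Set.InjOn (fun x : K × G => (p x.1).compSMul x.2) A := by
    rintro ⟨t, g⟩ hx ⟨t', g'⟩ hx' hxx
    simp only at hxx
    have h4 := congrArg (fun χ : B →ₐ[K] K => χ T) hxx
    simp only [AlgHom.compSMul_apply, h.smul_T, hp] at h4
    subst h4
    have hx1 : t ∈ R \ bad := (Finset.mem_product.1 hx).1
    rw [h.compSMul_injective (hpi t hx1) hxx]
  have hprop : ∀ x ∈ A, (Function.Injective fun i => (p x.1).compSMul x.2 (y i)) ∧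
      (p x.1).compSMul x.2 T ^ 2 ^ n = (p x.1).compSMul x.2 T := by
    rintro ⟨t, g⟩ hx
    have hx1 : t ∈ R \ bad := (Finset.mem_product.1 hx).1
    have hT : (p t).compSMul g T = t := by rw [AlgHom.compSMul_apply, h.smul_T, hp]
    refine ⟨h.injective_of_notMem hE ?_, ?_⟩
    · rw [hT]; exact (Finset.mem_sdiff.1 hx1).2
    · rw [hT]; exact hRn t (Finset.mem_sdiff.1 hx1).1
  let Z : Finset (B →ₐ[K] K) := A.image fun x => (p x.1).compSMul x.2
  have hZcard : Z.card = (R \ bad).card * D := by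
    rw [Finset.card_image_of_injOn hinj, Finset.card_product, Finset.card_univ]
  have hZ : ∀ χ ∈ Z, (Function.Injective fun i => χ (y i)) ∧ χ T ^ 2 ^ n = χ T := by
    intro χ hχ
    obtain ⟨x, hx, rfl⟩ := Finset.mem_image.1 hχ
    exact hprop x hx
  have hcover : Z ⊆ (Finset.univ.erase (1 : G)).biUnion
      fun g => Z.filter fun χ => ∀ b, χ (τ b) ^ 2 ^ n = χ (g • b) := by
    intro χ hχ
    obtain ⟨g, hg⟩ := h.exists_twist hσ hσq hτT (hZ χ hχ).2
    refine Finset.mem_biUnion.2 ⟨g, Finset.mem_erase.2 ⟨?_, Finset.mem_univ _⟩,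
      Finset.mem_filter.2 ⟨hχ, hg⟩⟩
    rintro rfl
    obtain ⟨i, hi⟩ := hcon χ (hZ χ hχ).1 (hZ χ hχ).2
    exact hi (by simpa [hτy] using hg (y i))
  set c := 1 + 2 * (κ * D) + 3 * κ with hc
  have hle : ∀ g : G, (Z.filter fun χ => ∀ b, χ (τ b) ^ 2 ^ n = χ (g • b)).card ≤ Q * (P + c) := by
    intro g
    have h5 := h.card_twisted_le hE (μ := n / 2) (ν := n - n / 2) (ℓ := ℓ) (M := M) hτ hσ
      (by rwa [hn2]) hτy
      (by rw [← hD, ← he, hκ, mul_assoc]; exact Nat.mul_lt_mul_of_pos_left h1 he0) ?_ g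
      (Z.filter fun χ => ∀ b, χ (τ b) ^ 2 ^ n = χ (g • b))
      (fun χ hχ => (hZ χ (Finset.mem_filter.1 hχ).1).1)
      (fun χ hχ => by rw [hn2]; exact (Finset.mem_filter.1 hχ).2)
    · rw [← hD, ← he, hκ, mul_assoc] at h5
      exact (Nat.le_of_mul_le_mul_left h5 he0).trans h3
    · refine lt_of_le_of_lt (h.finrank_le hE (N := κ * (ℓ * P + M) + 1) ?_)
        (h2.trans_le (Nat.mul_le_mul (hdim M) (hdim ℓ)))
      rw [← hD, ← he, hκ, mul_assoc]
      exact Nat.mul_lt_mul_of_pos_left (Nat.lt_succ_self _) he0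
  have h6 : (R \ bad).card * D ≤ (D - 1) * (Q * (P + c)) := by
    rw [← hZcard]
    refine (Finset.card_le_card hcover).trans (Finset.card_biUnion_le.trans ?_)
    refine (Finset.sum_le_card_nsmul _ _ _ fun g _ => hle g).trans ?_
    rw [Finset.card_erase_of_mem (Finset.mem_univ _), Finset.card_univ, smul_eq_mul]
  have h7 : R.card ≤ (R \ bad).card + e := by
    have := Finset.le_card_sdiff bad R
    omega
  exact false_of_count_le hD0 hκD heD Nat.one_le_two_pow hn (by rwa [← hq, ← hR]) h6

end IsRootCover

namespace IsRootCover

variable {K B G ι : Type*} [Field K] [CommRing B] [Algebra K B] [Group G]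
  [MulSemiringAction G B] [Fintype ι] {E : K[X]} {T : B} {y : ι → B}
  [IsDomain B] [Nonempty ι]

theorem T_ne_algebraMap (h : IsRootCover G E T y) (t : K) : T ≠ algebraMap K B t := by
  intro h0
  have : (X - C t : K[X]) = 0 := h.eq_zero_of_aeval_eq_zero (by simp [h0])
  exact X_sub_C_ne_zero _ this

theorem y_ne_algebraMap (h : IsRootCover G E T y) (i : ι) (t : K) : y i ≠ algebraMap K B t := by
  intro h0
  apply h.T_ne_algebraMap (eval t E)
  rw [← h.aeval_y i, h0, aeval_algebraMap_apply, coe_aeval_eq_eval]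

omit [IsDomain B] [Nonempty ι] in
theorem exists_algebraMap_eq (h : IsRootCover G E T y) {b : B} (hb : ∀ g : G, g • b = b) {M : ℕ}
    (hM : b ∈ degOneSpan K y ^ M) (hlt : M < Fintype.card ι) : ∃ c, b = algebraMap K B c := by
  obtain ⟨a, rfl⟩ := h.invariants b hb
  have h1 := h.deg_le a M hM
  have h2 : a.natDegree = 0 := by
    rcases Nat.eq_zero_or_pos a.natDegree with h0 | h0
    · exact h0
    · have := Nat.le_mul_of_pos_right (Fintype.card ι) h0
      omega
  rw [eq_C_of_natDegree_eq_zero h2, aeval_C]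
  exact ⟨_, rfl⟩

variable [SMulCommClass G K B] [Fintype G]

/-- At a point where `T - χ T` is not a uniformizer the inertia group is nontrivial. -/
theorem exists_compSMul_eq_self (h : IsRootCover G E T y) (χ : B →ₐ[K] K)
    (hT : T - algebraMap K B (χ T) ∈ RingHom.ker χ ^ 2) :
    ∃ g : G, g ≠ 1 ∧ χ.compSMul g = χ := by
  classical
  by_contra! hcon
  set m : Ideal B := RingHom.ker χ with hm
  have hmax : ∀ ψ : B →ₐ[K] K, (RingHom.ker ψ).IsMaximal := fun ψ =>
    RingHom.ker_isMaximal_of_surjective ψ fun c => ⟨algebraMap K B c, ψ.commutes c⟩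
  have hker : ∀ ψ : B →ₐ[K] K, RingHom.ker ψ = m → ψ = χ := by
    intro ψ hψ
    ext b
    have h1 : b - algebraMap K B (χ b) ∈ RingHom.ker ψ := by
      rw [hψ]; simp [hm, RingHom.mem_ker]
    simpa [RingHom.mem_ker, sub_eq_zero] using h1
  have hcop : ∀ g ∈ (Finset.univ : Finset G).erase 1,
      m ^ 2 ⊔ RingHom.ker (χ.compSMul g) ^ 2 = ⊤ := by
    intro g hg
    have := hmax χ
    have := hmax (χ.compSMul g)
    rw [← Ideal.isCoprime_iff_sup_eq]
    apply IsCoprime.pow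
    rw [Ideal.isCoprime_iff_sup_eq]
    exact Ideal.IsMaximal.coprime_of_ne (hmax χ) (hmax _)
      fun e => hcon g (Finset.ne_of_mem_erase hg) (hker _ e.symm)
  obtain ⟨c, hc, e, he, hce⟩ := Submodule.mem_sup.1
    ((Ideal.eq_top_iff_one _).1 (Ideal.sup_prod_eq_top hcop))
  have he1 : ∀ g ∈ (Finset.univ : Finset G).erase 1, g • e ∈ m ^ 2 := by
    intro g hg
    have h1 : e ∈ RingHom.ker (χ.compSMul g) ^ 2 :=
      Ideal.le_of_dvd (Finset.dvd_prod_of_mem _ hg) he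
    exact Ideal.le_comap_pow (MulSemiringAction.toRingHom G B g) (K := m) 2 h1
  have hidem : IsIdempotentElem m := by
    refine le_antisymm Ideal.mul_le_right fun x hx => ?_
    obtain ⟨a, ha⟩ := h.exists_trace (G := G) (x * e)
    have h2 : x - aeval T a ∈ m ^ 2 := by
      rw [ha, ← Finset.add_sum_erase _ _ (Finset.mem_univ (1 : G)), one_smul, ← sub_sub,
        show x - x * e = x * c by linear_combination -x * hce]
      refine sub_mem (Ideal.mul_mem_left _ _ hc) (Submodule.sum_mem _ fun g hg => ?_)
      rw [smul_mul']
      exact Ideal.mul_mem_left _ _ (he1 g hg)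
    have h3 : eval (χ T) a = 0 := by
      have h4 : χ (x - aeval T a) = 0 := Ideal.pow_le_self two_ne_zero h2
      rw [map_sub, show χ x = 0 from hx, zero_sub, neg_eq_zero, ← aeval_algHom_apply] at h4
      simpa using h4
    obtain ⟨a', rfl⟩ := dvd_iff_isRoot.2 h3
    have h5 : aeval T ((X - C (χ T)) * a') ∈ m ^ 2 := by
      rw [map_mul, map_sub, aeval_X, aeval_C]
      exact Ideal.mul_mem_right _ _ hT
    have := add_mem h2 h5
    rwa [sub_add_cancel, sq] at this
  have := h.finiteType
  have : IsNoetherianRing B := Algebra.FiniteType.isNoetherianRing K B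
  rcases (Ideal.isIdempotentElem_iff_eq_bot_or_top m
    ((isNoetherianRing_iff_ideal_fg B).1 inferInstance m)).1 hidem with h0 | h0
  · have h1 : T - algebraMap K B (χ T) ∈ m := Ideal.pow_le_self two_ne_zero hT
    rw [h0, Ideal.mem_bot, sub_eq_zero] at h1
    exact h.T_ne_algebraMap _ h1
  · exact (hmax χ).ne_top h0

section Transitive

variable [MulAction G ι] [IsAlgClosed K]

theorem isPretransitive (h : IsRootCover G E T y) (hy : ∀ (g : G) i, y (g • i) = g • y i) :
    MulAction.IsPretransitive G ι := by
  classical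
  obtain ⟨χ, -⟩ := h.exists_point 0
  constructor
  intro i j
  let O : Finset ι := Finset.univ.filter fun k => ∃ g : G, g • i = k
  suffices O = Finset.univ by
    have h1 : j ∈ O := by rw [this]; exact Finset.mem_univ j
    exact (Finset.mem_filter.1 h1).2
  obtain ⟨a, ha⟩ := h.invariants (∏ k ∈ O, (y k - algebraMap K B (χ (y i)))) (by
    intro g
    rw [Finset.smul_prod']
    refine Finset.prod_bij' (fun k _ => g • k) (fun k _ => g⁻¹ • k) ?_ ?_ ?_ ?_ ?_
    · intro k hk
      obtain ⟨g', rfl⟩ := (Finset.mem_filter.1 hk).2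
      exact Finset.mem_filter.2 ⟨Finset.mem_univ _, g * g', mul_smul _ _ _⟩
    · intro k hk
      obtain ⟨g', rfl⟩ := (Finset.mem_filter.1 hk).2
      exact Finset.mem_filter.2 ⟨Finset.mem_univ _, g⁻¹ * g', mul_smul _ _ _⟩
    · simp
    · simp
    · intro k _
      rw [smul_sub, smul_algebraMap, hy])
  have ha0 : a ≠ 0 := by
    rintro rfl
    rw [map_zero] at ha
    obtain ⟨k, -, hk⟩ := Finset.prod_eq_zero_iff.1 ha.symm
    exact h.y_ne_algebraMap k _ (sub_eq_zero.1 hk)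
  have hr : a.IsRoot (χ T) := by
    have h1 := congrArg χ ha
    rw [← aeval_algHom_apply, coe_aeval_eq_eval, map_prod, Finset.prod_eq_zero
      (Finset.mem_filter.2 ⟨Finset.mem_univ i, 1, one_smul _ _⟩) (by simp)] at h1
    exact h1
  have hdeg : 0 < a.natDegree := natDegree_pos_iff_degree_pos.2 (degree_pos_of_root ha0 hr)
  have h2 := h.deg_le a (O.card * 1) (by
    rw [ha]
    refine prod_mem_degOneSpan O fun k _ => ?_
    rw [pow_one]
    refine sub_mem (mem_degOneSpan y k) ?_
    simpa using algebraMap_mem_degOneSpan y 1 (χ (y i)))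
  rw [← Finset.card_eq_iff_eq_univ]
  refine le_antisymm (Finset.card_le_univ O) ?_
  have := Nat.le_mul_of_pos_right (Fintype.card ι) hdeg
  omega

theorem card_dvd_card (h : IsRootCover G E T y) (hy : ∀ (g : G) i, y (g • i) = g • y i) :
    Fintype.card ι ∣ Fintype.card G := by
  classical
  have := h.isPretransitive hy
  obtain ⟨i⟩ := ‹Nonempty ι›
  have h1 := MulAction.card_orbit_mul_card_stabilizer_eq_card_group G i
  rw [← h1]
  refine Dvd.intro _ (congrArg (· * _) ?_)
  rw [← Fintype.card_congr (Equiv.Set.univ ι)]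
  exact (Fintype.card_congr (Equiv.setCongr (MulAction.orbit_eq_univ G i))).symm

end Transitive

end IsRootCover

theorem coeff_prod_mem_degOneSpan {K B ι : Type*} [Field K] [CommRing B] [Algebra K B] {y : ι → B}
    (S : Finset ι) (n : ℕ) : (∏ i ∈ S, (X - C (y i))).coeff n ∈ degOneSpan K y ^ S.card := by
  classical
  induction S using Finset.induction_on generalizing n with
  | empty =>
    rw [Finset.prod_empty, coeff_one]
    split_ifs
    · exact degOneSpan_pow_mono y (Nat.zero_le _) (by simpa using ⟨1, map_one _⟩)
    · exact zero_mem _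
  | insert i S hi ih =>
    rw [Finset.prod_insert hi, Finset.card_insert_of_notMem hi, sub_mul, coeff_sub, coeff_C_mul]
    refine sub_mem ?_ ?_
    · rcases n with _ | n
      · simp
      · rw [coeff_X_mul]
        exact degOneSpan_pow_mono y (Nat.le_succ _) (ih n)
    · rw [pow_succ']
      exact Submodule.mul_mem_mul (mem_degOneSpan y i) (ih n)

theorem even_card_of_involution {ι : Type*} (S : Finset ι) (f : ι → ι) (hf : ∀ i, f i ≠ i)
    (hff : ∀ i, f (f i) = i) (hS : ∀ i ∈ S, f i ∈ S) : Even S.card := by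
  have h1 : ∑ _i ∈ S, (1 : ZMod 2) = 0 :=
    Finset.sum_involution (fun i _ => f i) (fun _ _ => by decide) (fun i _ _ => hf i) hS
      fun i _ => hff i
  rw [Finset.sum_const, nsmul_one] at h1
  rwa [← ZMod.natCast_eq_zero_iff_even]

namespace IsRootCover

variable {K B G ι : Type*} [Field K] [CommRing B] [Algebra K B] [Group G]
  [MulSemiringAction G B] [Fintype ι] {E : K[X]} {T : B} {y : ι → B}
  [IsDomain B] [Nonempty ι] [SMulCommClass G K B] [Fintype G] [MulAction G ι] [IsAlgClosed K]

/-- An invariant equivalence relation which relates all pairs of roots that collide at some point,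
and which has oddly many classes, relates all roots. -/
theorem rel_of_collisions [CharP K 2] (h : IsRootCover G E T y)
    (hy : ∀ (g : G) i, y (g • i) = g • y i)
    (s : Setoid ι) (hs : ∀ (g : G) i j, s.r i j → s.r (g • i) (g • j))
    (hcol : ∀ (χ : B →ₐ[K] K) i j, χ (y i) = χ (y j) → s.r i j)
    (f : ι → ι) (hf : ∀ i, f i ≠ i) (hff : ∀ i, f (f i) = i) (hfs : ∀ i, s.r i (f i))
    (h4 : ¬ 4 ∣ Fintype.card ι) (i j : ι) : s.r i j := by
  classical
  have : CharP B 2 := charP_of_injective_algebraMap (algebraMap K B).injective 2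
  have := h.isPretransitive hy
  by_contra hij
  let cls : ι → Finset ι := fun i => Finset.univ.filter fun j => s.r i j
  have hmem : ∀ i j, j ∈ cls i ↔ s.r i j := fun i j => by simp [cls]
  have hself : ∀ i, i ∈ cls i := fun i => (hmem i i).2 (s.refl i)
  have hcls : ∀ i j, s.r i j → cls i = cls j := by
    intro i j hij
    ext k
    rw [hmem, hmem]
    exact ⟨fun hk => s.trans (s.symm hij) hk, fun hk => s.trans hij hk⟩
  have hclsg : ∀ (g : G) i, cls (g • i) = (cls i).image fun k => g • k := by
    intro g i
    ext k
    rw [hmem, Finset.mem_image]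
    constructor
    · intro hk
      refine ⟨g⁻¹ • k, (hmem _ _).2 ?_, smul_inv_smul g k⟩
      simpa using hs g⁻¹ _ _ hk
    · rintro ⟨l, hl, rfl⟩
      exact hs g _ _ ((hmem _ _).1 hl)
  have hcard : ∀ k, (cls k).card = (cls i).card := by
    intro k
    obtain ⟨g, rfl⟩ := MulAction.exists_smul_eq G i k
    rw [hclsg, Finset.card_image_of_injective _ (MulAction.injective g)]
  let Cl : Finset (Finset ι) := Finset.univ.image cls
  have hCl : ∀ Δ ∈ Cl, ∃ k, Δ = cls k := by
    intro Δ hΔ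
    obtain ⟨k, -, rfl⟩ := Finset.mem_image.1 hΔ
    exact ⟨k, rfl⟩
  have hclsCl : ∀ k, cls k ∈ Cl := fun k => Finset.mem_image_of_mem _ (Finset.mem_univ k)
  have htotal : Fintype.card ι = Cl.card * (cls i).card := by
    rw [← Finset.card_univ, Finset.card_eq_sum_card_image cls Finset.univ, ← smul_eq_mul,
      ← Finset.sum_const]
    refine Finset.sum_congr rfl fun Δ hΔ => ?_
    obtain ⟨k, rfl⟩ := hCl Δ hΔ
    rw [← hcard k]
    congr 1
    ext l
    rw [Finset.mem_filter, hmem]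
    refine ⟨fun hl => (hmem _ _).1 (hl.2 ▸ hself l), fun hl => ⟨Finset.mem_univ _, (hcls _ _ hl).symm⟩⟩
  have hodd : Odd Cl.card := by
    by_contra hev
    rw [Nat.not_odd_iff_even] at hev
    apply h4
    rw [htotal]
    have h1 : Even (cls i).card := even_card_of_involution _ f hf hff fun k hk => by
      rw [hmem] at hk ⊢
      exact s.trans hk (hfs k)
    exact mul_dvd_mul (even_iff_two_dvd.1 hev) (even_iff_two_dvd.1 h1)
  let H : B[X] := ∑ Δ ∈ Cl, ∏ k ∈ Δᶜ, (X - C (y k))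
  have hH : ∀ n, ∃ c, H.coeff n = algebraMap K B c := by
    intro n
    refine h.exists_algebraMap_eq (G := G) (M := Fintype.card ι - 1) ?_ ?_
      (Nat.sub_lt Fintype.card_pos one_pos)
    · intro g
      have h1 : H.map (MulSemiringAction.toRingHom G B g) = H := by
        simp only [H, Polynomial.map_sum, Polynomial.map_prod]
        refine Finset.sum_bij' (fun Δ _ => Δ.image fun k => g • k)
          (fun Δ _ => Δ.image fun k => g⁻¹ • k) ?_ ?_ ?_ ?_ ?_
        · intro Δ hΔ
          obtain ⟨k, rfl⟩ := hCl Δ hΔ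
          rw [← hclsg]; exact hclsCl _
        · intro Δ hΔ
          obtain ⟨k, rfl⟩ := hCl Δ hΔ
          rw [← hclsg]; exact hclsCl _
        · intro Δ _
          rw [Finset.image_image]
          simp [Function.comp_def]
        · intro Δ _
          rw [Finset.image_image]
          simp [Function.comp_def]
        · intro Δ _
          refine Finset.prod_bij' (fun k _ => g • k) (fun k _ => g⁻¹ • k) ?_ ?_ ?_ ?_ ?_
          · intro k hk
            rw [Finset.mem_compl] at hk ⊢
            rw [Finset.mem_image]
            rintro ⟨l, hl, hlk⟩
            exact hk (MulAction.injective g hlk ▸ hl)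
          · intro k hk
            rw [Finset.mem_compl] at hk ⊢
            intro hk'
            exact hk (Finset.mem_image.2 ⟨_, hk', smul_inv_smul g k⟩)
          · simp
          · simp
          · intro k _
            simp [hy]
      conv_rhs => rw [← h1]
      rw [coeff_map]; rfl
    · simp only [H, finsetSum_coeff]
      refine Submodule.sum_mem _ fun Δ hΔ => ?_
      refine degOneSpan_pow_mono y ?_ (coeff_prod_mem_degOneSpan Δᶜ n)
      obtain ⟨k, rfl⟩ := hCl Δ hΔ
      rw [Finset.card_compl]
      have : 0 < (cls k).card := Finset.card_pos.2 ⟨k, hself k⟩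
      omega
  obtain ⟨H₀, hH₀⟩ : ∃ H₀ : K[X], H₀.map (algebraMap K B) = H := by
    have : H ∈ lifts (algebraMap K B) := by
      rw [lifts_iff_coeff_lifts]
      intro n
      obtain ⟨c, hc⟩ := hH n
      exact ⟨c, hc.symm⟩
    obtain ⟨H₀, hH₀⟩ := (mem_lifts H).1 this
    exact ⟨H₀, hH₀⟩
  have hcoeff : H.coeff (Fintype.card ι - (cls i).card) = 1 := by
    simp only [H, finsetSum_coeff]
    have h1 : ∀ Δ ∈ Cl, (∏ k ∈ Δᶜ, (X - C (y k))).coeff (Fintype.card ι - (cls i).card) = 1 := by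
      intro Δ hΔ
      obtain ⟨k, rfl⟩ := hCl Δ hΔ
      have h2 : (∏ k ∈ (cls k)ᶜ, (X - C (y k))).natDegree = Fintype.card ι - (cls i).card := by
        rw [natDegree_prod_of_monic _ _ fun i _ => monic_X_sub_C _]
        simp [Finset.card_compl, hcard k]
      rw [← h2]
      exact monic_prod_of_monic _ _ fun i _ => monic_X_sub_C _
    rw [Finset.sum_congr rfl h1, Finset.sum_const, nsmul_one]
    obtain ⟨r, hr⟩ := hodd
    rw [hr]
    simp [CharTwo.two_eq_zero]
  have hlt : (cls i).card < Fintype.card ι := by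
    refine Finset.card_lt_univ_of_notMem (x := j) ?_
    rwa [hmem]
  have hdeg : H₀.degree ≠ 0 := by
    intro h0
    rw [eq_C_of_degree_eq_zero h0] at hH₀
    rw [← hH₀, map_C, coeff_C, if_neg (by omega)] at hcoeff
    exact zero_ne_one hcoeff
  obtain ⟨c, hc⟩ := IsAlgClosed.exists_root H₀ hdeg
  obtain ⟨χ, hχ⟩ := h.exists_point (eval c E)
  obtain ⟨k, hk⟩ := h.exists_map_eq χ hχ.symm
  have h1 : eval c (H.map (χ : B →+* K)) = 0 := by
    rw [← hH₀, Polynomial.map_map]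
    have : (χ : B →+* K).comp (algebraMap K B) = RingHom.id K := by ext; simp
    rw [this, Polynomial.map_id]
    exact hc
  simp only [H, Polynomial.map_sum, Polynomial.map_prod, eval_finsetSum, eval_prod] at h1
  rw [Finset.sum_eq_single (cls k)] at h1
  · obtain ⟨l, hl, hl0⟩ := Finset.prod_eq_zero_iff.1 h1
    rw [Finset.mem_compl, hmem] at hl
    apply hl
    apply hcol χ
    rw [hk]
    simpa [sub_eq_zero] using hl0
  · intro Δ hΔ hne
    obtain ⟨l, rfl⟩ := hCl Δ hΔ
    refine Finset.prod_eq_zero (i := k) ?_ (by simp [hk])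
    rw [Finset.mem_compl, hmem]
    exact fun hlk => hne (hcls _ _ hlk)
  · exact fun hn => absurd (hclsCl k) hn

end IsRootCover

section SignedPermutations

variable {G ι : Type*} [Group G] [MulAction G ι]

/-- Some element of `G` swaps `i` and `j` and fixes all elements other than `i`, `j`, `f i` and
`f j`. -/
def HasReflection (G : Type*) {ι : Type*} [Group G] [MulAction G ι] (f : ι → ι) (i j : ι) : Prop :=
  ∃ g : G, g • i = j ∧ g • j = i ∧ ∀ k, k ≠ i → k ≠ j → k ≠ f i → k ≠ f j → g • k = k

/-- Some element of `G` swaps `i` and `f i`, swaps `j` and `f j`, and fixes all other elements. -/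
def HasFlip (G : Type*) {ι : Type*} [Group G] [MulAction G ι] (f : ι → ι) (i j : ι) : Prop :=
  ∃ g : G, g • i = f i ∧ g • j = f j ∧ ∀ k, k ≠ i → k ≠ j → k ≠ f i → k ≠ f j → g • k = k

variable {f : ι → ι}

theorem HasReflection.symm {i j : ι} (h : HasReflection G f i j) : HasReflection G f j i := by
  obtain ⟨g, h1, h2, h3⟩ := h
  exact ⟨g, h2, h1, fun k a b c d => h3 k b a d c⟩

theorem HasReflection.smul (hfg : ∀ (g : G) i, f (g • i) = g • f i) {i j : ι}
    (h : HasReflection G f i j) (g : G) : HasReflection G f (g • i) (g • j) := by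
  obtain ⟨r, h1, h2, h3⟩ := h
  refine ⟨g * r * g⁻¹, by simp [mul_smul, h1], by simp [mul_smul, h2], fun k a b c d => ?_⟩
  rw [hfg] at c d
  rw [mul_smul, mul_smul, h3, smul_inv_smul]
  all_goals rw [Ne, inv_smul_eq_iff]; assumption

theorem HasFlip.smul (hfg : ∀ (g : G) i, f (g • i) = g • f i) {i j : ι}
    (h : HasFlip G f i j) (g : G) : HasFlip G f (g • i) (g • j) := by
  obtain ⟨r, h1, h2, h3⟩ := h
  refine ⟨g * r * g⁻¹, by simp [mul_smul, h1, hfg], by simp [mul_smul, h2, hfg],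
    fun k a b c d => ?_⟩
  rw [hfg] at c d
  rw [mul_smul, mul_smul, h3, smul_inv_smul]
  all_goals rw [Ne, inv_smul_eq_iff]; assumption

theorem HasFlip.symm {i j : ι} (h : HasFlip G f i j) : HasFlip G f j i := by
  obtain ⟨g, h1, h2, h3⟩ := h
  exact ⟨g, h2, h1, fun k a b c d => h3 k b a d c⟩

theorem HasReflection.map (hff : ∀ i, f (f i) = i) (hfg : ∀ (g : G) i, f (g • i) = g • f i)
    {i j : ι} (h : HasReflection G f i j) : HasReflection G f (f i) (f j) := by
  obtain ⟨g, h1, h2, h3⟩ := h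
  refine ⟨g, by rw [← hfg, h1], by rw [← hfg, h2], fun k a b c d => ?_⟩
  rw [hff] at c d
  exact h3 k c d a b

theorem HasFlip.map_left (hff : ∀ i, f (f i) = i) (hfg : ∀ (g : G) i, f (g • i) = g • f i)
    {i j : ι} (h : HasFlip G f i j) : HasFlip G f (f i) j := by
  obtain ⟨g, h1, h2, h3⟩ := h
  refine ⟨g, by rw [← hfg, h1], h2, fun k a b c d => ?_⟩
  rw [hff] at c
  exact h3 k c b a d

theorem HasReflection.trans (hfg : ∀ (g : G) i, f (g • i) = g • f i)
    {i j k : ι} (hij : HasReflection G f i j) (hjk : HasReflection G f j k)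
    (h1 : k ≠ i) (h2 : k ≠ f i) (h3 : k ≠ j) (h4 : k ≠ f j) : HasReflection G f i k := by
  obtain ⟨g, g1, g2, g3⟩ := hij
  have := hjk.smul hfg g
  rwa [g2, g3 k h1 h3 h2 h4] at this

variable (G f) in
/-- Two elements are related if they are equal up to `f`, or if a reflection swaps them up
to `f`. -/
def reflectionSetoid (hff : ∀ i, f (f i) = i) (hfg : ∀ (g : G) i, f (g • i) = g • f i) :
    Setoid ι where
  r i j := j = i ∨ j = f i ∨ HasReflection G f i j ∨ HasReflection G f i (f j)
  iseqv := by
    constructor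
    · exact fun i => Or.inl rfl
    · rintro i j (rfl | rfl | h | h)
      · exact Or.inl rfl
      · exact Or.inr (Or.inl (hff i).symm)
      · exact Or.inr (Or.inr (Or.inl h.symm))
      · refine Or.inr (Or.inr (Or.inr ?_))
        have := (h.map hff hfg).symm
        rwa [hff] at this
    · intro i j k hij hjk
      by_cases h1 : k = i
      · exact Or.inl h1
      by_cases h2 : k = f i
      · exact Or.inr (Or.inl h2)
      right; right
      by_cases h3 : k = j
      · subst h3
        exact hij.resolve_left h1 |>.resolve_left h2
      by_cases h4 : k = f j
      · subst h4
        have h5 : j ≠ i := fun e => h2 (by rw [e])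
        have h6 : j ≠ f i := fun e => h1 (by rw [e, hff])
        rw [hff]
        exact (hij.resolve_left h5 |>.resolve_left h6).symm
      have h5 : f k ≠ i := fun e => h2 (by rw [← e, hff])
      have h6 : f k ≠ f i := fun e => h1 (by rw [← hff k, e, hff])
      have h7 : f k ≠ j := fun e => h4 (by rw [← e, hff])
      have h8 : f k ≠ f j := fun e => h3 (by rw [← hff k, e, hff])
      have hjk := hjk.resolve_left h3 |>.resolve_left h4
      rcases hij with rfl | rfl | hij | hij
      · exact hjk
      · rcases hjk with hjk | hjk
        · have := hjk.map hff hfg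
          rw [hff] at this
          exact Or.inr this
        · have := hjk.map hff hfg
          rw [hff, hff] at this
          exact Or.inl this
      · rcases hjk with hjk | hjk
        · exact Or.inl (hij.trans hfg hjk h1 h2 h3 h4)
        · exact Or.inr (hij.trans hfg hjk h5 h6 h7 h8)
      · rcases hjk with hjk | hjk
        · exact Or.inr (hij.trans hfg (hjk.map hff hfg) h5 h6 h8 (by rwa [hff]))
        · have := hjk.map hff hfg
          rw [hff] at this
          exact Or.inl (hij.trans hfg this h1 h2 h4 (by rwa [hff]))

variable (hff : ∀ i, f (f i) = i) (hfg : ∀ (g : G) i, f (g • i) = g • f i)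

include hff hfg in
theorem reflectionSetoid_smul (g : G) {i j : ι} (h : (reflectionSetoid G f hff hfg).r i j) :
    (reflectionSetoid G f hff hfg).r (g • i) (g • j) := by
  rcases h with rfl | rfl | h | h
  · exact Or.inl rfl
  · exact Or.inr (Or.inl (hfg g i).symm)
  · exact Or.inr (Or.inr (Or.inl (h.smul hfg g)))
  · refine Or.inr (Or.inr (Or.inr ?_))
    rw [hfg]
    exact h.smul hfg g

include hff hfg in
theorem HasReflection.hasFlip {i j : ι} (h1 : HasReflection G f i j)
    (h2 : HasReflection G f i (f j)) : HasFlip G f i j := by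
  obtain ⟨g, g1, g2, g3⟩ := h1
  obtain ⟨r, r1, r2, r3⟩ := h2
  refine ⟨g * r, ?_, ?_, fun k a b c d => ?_⟩
  · rw [mul_smul, r1, ← hfg, g2]
  · have : r • j = f i := by rw [← hff j, ← hfg, r2]
    rw [mul_smul, this, ← hfg, g1]
  · rw [mul_smul, r3 k a d c (by rwa [hff]), g3 k a b c d]

include hff hfg in
theorem HasFlip.hasReflection {i j : ι} (h1 : HasFlip G f i j)
    (h2 : HasReflection G f i (f j)) : HasReflection G f i j := by
  obtain ⟨g, g1, g2, g3⟩ := h1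
  obtain ⟨r, r1, r2, r3⟩ := h2
  refine ⟨g * r, ?_, ?_, fun k a b c d => ?_⟩
  · rw [mul_smul, r1, ← hfg, g2, hff]
  · have : r • j = f i := by rw [← hff j, ← hfg, r2]
    rw [mul_smul, this, ← hfg, g1, hff]
  · rw [mul_smul, r3 k a d c (by rwa [hff]), g3 k a b c d]

include hff hfg in
/-- If all elements are related by reflections, then a single flip produces all flips and all
reflections. -/
theorem HasFlip.all (hall : ∀ i j, (reflectionSetoid G f hff hfg).r i j) {i j : ι}
    (h : HasFlip G f i j) (hij : j ≠ i) (hij' : j ≠ f i) {k l : ι} (hkl : l ≠ k)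
    (hkl' : l ≠ f k) : HasFlip G f k l ∧ HasReflection G f k l := by
  have hne : ∀ {a b : ι}, b ≠ a → b ≠ f a → a ≠ b ∧ a ≠ f b := fun {a b} h1 h2 =>
    ⟨h1.symm, fun e => h2 (by rw [e, hff])⟩
  have move : ∀ {a b c : ι}, HasFlip G f a b → b ≠ a → b ≠ f a → c ≠ b → c ≠ f b →
      HasFlip G f c b := by
    intro a b c hab h1 h2 h3 h4
    rcases hall a c with rfl | rfl | ⟨g, g1, g2, g3⟩ | ⟨g, g1, g2, g3⟩
    · exact hab
    · exact hab.map_left hff hfg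
    · have h5 := hab.smul hfg g
      rwa [g1, g3 b h1 h3.symm h2 (hne h3 h4).2] at h5
    · have h5 := hab.smul hfg g
      rw [g1, g3 b h1 (hne h3 h4).2 h2 (by rw [hff]; exact h3.symm)] at h5
      have := h5.map_left hff hfg
      rwa [hff] at this
  have hflip : HasFlip G f k l := by
    have last : ∀ {a : ι}, HasFlip G f k a → a ≠ k → a ≠ f k → HasFlip G f k l :=
      fun h1 h2 h3 => (move h1.symm (hne h2 h3).1 (hne h2 h3).2 hkl hkl').symm
    by_cases h1 : k = j
    · subst h1
      exact last h.symm (hne hij hij').1 (hne hij hij').2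
    by_cases h2 : k = f j
    · subst h2
      exact last (h.symm.map_left hff hfg) (hne hij hij').2 (by rw [hff]; exact hij.symm)
    exact last (move h hij hij' h1 h2) (Ne.symm h1) fun e => h2 (by rw [e, hff])
  refine ⟨hflip, ?_⟩
  rcases hall k l with h1 | h1 | h1 | h1
  · exact absurd h1 hkl
  · exact absurd h1 hkl'
  · exact h1
  · exact hflip.hasReflection hff hfg h1

include hff hfg in
/-- If there are no flips then `G` preserves, up to `f`, a set of representatives for the orbits
of `f`. -/
theorem exists_section_of_no_flip [Fintype ι] [MulAction.IsPretransitive G ι] [Nonempty ι]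
    (hf : ∀ i, f i ≠ i) (hall : ∀ i j, (reflectionSetoid G f hff hfg).r i j)
    (hno : ∀ i j, j ≠ i → j ≠ f i → ¬ HasFlip G f i j) :
    ∃ O : Finset ι, (∀ k, k ∈ O ↔ f k ∉ O) ∧
      (∀ g : G, (∀ k ∈ O, g • k ∈ O) ∨ ∀ k ∈ O, f (g • k) ∈ O) ∧
      ∃ g : G, ∀ k ∈ O, f (g • k) ∈ O := by
  classical
  obtain ⟨i⟩ := ‹Nonempty ι›
  let O : Finset ι := Finset.univ.filter fun k => k ≠ f i ∧ HasReflection G f i k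
  have hO : ∀ k, k ∈ O ↔ k ≠ f i ∧ HasReflection G f i k := fun k => by simp [O]
  have hiO : i ∈ O := (hO i).2 ⟨(hf i).symm, 1, by simp⟩
  have hfi : f i ∉ O := fun h => ((hO _).1 h).1 rfl
  have hsec : ∀ k, k ∈ O ↔ f k ∉ O := by
    intro k
    by_cases h1 : k = i
    · subst h1
      simp [hiO, hfi]
    by_cases h2 : k = f i
    · subst h2
      simp [hiO, hfi, hff]
    have h3 : f k ≠ f i := fun e => h1 (by rw [← hff k, e, hff])
    simp only [hO, ne_eq, h2, h3, not_false_iff, true_and]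
    refine ⟨fun h4 h5 => hno i k h1 h2 (h4.hasFlip hff hfg h5), fun h4 => ?_⟩
    rcases hall i k with h5 | h5 | h5 | h5
    · exact absurd h5 h1
    · exact absurd h5 h2
    · exact h5
    · exact absurd h5 h4
  have hstep : ∀ a b, a ∈ O → HasReflection G f a b → b ≠ f a → b ∈ O := by
    intro a b ha hab hb
    have hia := ((hO a).1 ha).2
    by_cases h1 : a = i
    · subst h1
      exact (hO b).2 ⟨hb, hab⟩
    by_cases h2 : b = i
    · rwa [h2]
    by_cases h3 : b = a
    · rwa [h3]
    have h4 : b ≠ f i := by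
      rintro rfl
      have h5 := (hab.map hff hfg).symm
      rw [hff] at h5
      exact hno i a h1 ((hO a).1 ha).1 (hia.hasFlip hff hfg h5)
    exact (hO b).2 ⟨h4, hia.trans hfg hab h2 h4 h3 hb⟩
  have hdich : ∀ g : G, (g • i ∈ O → ∀ k ∈ O, g • k ∈ O) ∧
      (f (g • i) ∈ O → ∀ k ∈ O, f (g • k) ∈ O) := by
    intro g
    refine ⟨fun h1 k hk => ?_, fun h1 k hk => ?_⟩
    · refine hstep _ _ h1 (((hO k).1 hk).2.smul hfg g) ?_
      rw [hfg]
      exact fun e => ((hO k).1 hk).1 (MulAction.injective g e)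
    · refine hstep _ _ h1 ((((hO k).1 hk).2.smul hfg g).map hff hfg) ?_
      rw [hff, hfg]
      intro e
      apply ((hO k).1 hk).1
      rw [← hff k, MulAction.injective g e]
  refine ⟨O, hsec, fun g => ?_, ?_⟩
  · by_cases h1 : g • i ∈ O
    · exact Or.inl ((hdich g).1 h1)
    · right
      refine (hdich g).2 ?_
      by_contra h2
      exact h1 ((hsec _).2 h2)
  · obtain ⟨g, hg⟩ := MulAction.exists_smul_eq G i (f i)
    exact ⟨g, (hdich g).2 (by rw [hg, hff]; exact hiO)⟩

include hff in
theorem exists_section [Fintype ι] (hf : ∀ i, f i ≠ i) (i : ι) :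
    ∃ O : Finset ι, (∀ k, k ∈ O ↔ f k ∉ O) ∧ i ∈ O := by
  classical
  let e := Fintype.equivFin ι
  have key : ∃ O : Finset ι, ∀ k, k ∈ O ↔ f k ∉ O := by
    refine ⟨Finset.univ.filter fun k => e k < e (f k), fun k => ?_⟩
    have : e k ≠ e (f k) := fun h => hf k (e.injective h).symm
    simp only [Finset.mem_filter, Finset.mem_univ, true_and, hff, not_lt]
    exact ⟨le_of_lt, fun h => lt_of_le_of_ne h this⟩
  obtain ⟨O, hO⟩ := key
  by_cases h : i ∈ O
  · exact ⟨O, hO, h⟩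
  · refine ⟨Oᶜ, fun k => ?_, Finset.mem_compl.2 h⟩
    rw [Finset.mem_compl, Finset.mem_compl, hO k]

include hff hfg in
/-- A permutation commuting with `f` can be corrected by an element of `G` so as to fix everything,
or to exchange exactly two elements. -/
theorem exists_smul_fix [Fintype ι] (hall : ∀ i j, j ≠ i → j ≠ f i →
      HasFlip G f i j ∧ HasReflection G f i j)
    (π : ι → ι) (hπ : Function.Injective π) (hπf : ∀ i, π (f i) = f (π i)) :
    ∃ g : G, (∀ i, g • π i = i) ∨
      ∃ i, g • π i = f i ∧ ∀ k, k ≠ i → k ≠ f i → g • π k = k := by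
  classical
  let fix : G → Finset ι := fun g => Finset.univ.filter fun i => g • π i = i
  have hfix : ∀ g i, i ∈ fix g ↔ g • π i = i := fun g i => by simp [fix]
  obtain ⟨g, hg⟩ : ∃ g, ∀ g', (fix g').card ≤ (fix g).card := by
    have hfin : (Set.range fun g => (fix g).card).Finite :=
      (Set.finite_Iic (Fintype.card ι)).subset (by
        rintro _ ⟨g, rfl⟩
        exact Finset.card_le_univ _)
    obtain ⟨_, ⟨g, rfl⟩, hg⟩ := Set.exists_max_image _ id hfin ⟨_, 1, rfl⟩
    exact ⟨g, fun g' => hg _ ⟨g', rfl⟩⟩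
  refine ⟨g, ?_⟩
  have hρ : Function.Injective fun i => g • π i := (MulAction.injective g).comp hπ
  have hρf : ∀ i, g • π (f i) = f (g • π i) := fun i => by rw [hπf, hfg]
  have hmax : ∀ (g' : G) i, g • π i ≠ i → (∀ k, g • π k = k → g' • k = k) →
      g' • g • π i ≠ i := by
    intro g' i hi hk hi'
    have h1 : insert i (fix g) ⊆ fix (g' * g) := by
      intro k hk'
      rw [hfix, mul_smul]
      rcases Finset.mem_insert.1 hk' with rfl | hk'
      · exact hi'
      · rw [(hfix _ _).1 hk', hk k ((hfix _ _).1 hk')]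
    have h2 := Finset.card_le_card h1
    rw [Finset.card_insert_of_notMem (by rwa [hfix])] at h2
    have := hg (g' * g)
    omega
  have hmem : ∀ i, g • π i = i ∨ g • π i = f i := by
    intro i
    by_contra! hi
    obtain ⟨r, r1, r2, r3⟩ := (hall i _ hi.1 hi.2).2
    refine hmax r i hi.1 (fun k hk => r3 k ?_ ?_ ?_ ?_) r2
    · rintro rfl; exact hi.1 hk
    · intro e
      exact hi.1 (hρ (by simp only; rw [← e, hk, e]))
    · rintro rfl
      rw [hρf] at hk
      exact hi.1 (by rw [← hff (g • π i), hk, hff])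
    · intro e
      rw [e] at hk
      rw [← hρf] at hk
      have := hρ (show g • π (g • π (f i)) = g • π (f i) from hk)
      rw [hρf] at this
      exact hi.1 (by rw [← hff (g • π i), this, hff])
  by_cases hid : ∀ i, g • π i = i
  · exact Or.inl hid
  · right
    push Not at hid
    obtain ⟨i, hi⟩ := hid
    refine ⟨i, (hmem i).resolve_left hi, fun k h1 h2 => ?_⟩
    by_contra hk
    obtain ⟨r, r1, r2, r3⟩ := (hall i k h1 h2).1
    have hi' := (hmem i).resolve_left hi
    have hk' := (hmem k).resolve_left hk
    refine hmax r i hi (fun l hl => r3 l ?_ ?_ ?_ ?_) ?_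
    · rintro rfl; exact hi hl
    · rintro rfl; exact hk hl
    · rintro rfl
      rw [hρf, hi'] at hl
      exact hi (by rw [hi', ← hl, hff])
    · rintro rfl
      rw [hρf, hk'] at hl
      exact hk (by rw [hk', ← hl, hff])
    · rw [hi', ← hfg, r1, hff]

end SignedPermutations

/-- The second elementary symmetric function of the union of the pairs `y i`, `y i + 1`. -/
theorem coeff_prod_pairs {B ι : Type*} [CommRing B] [Nontrivial B] (u : ι → B) (O : Finset ι) :
    ∃ R : B[X], R.degree < (2 * O.card : ℕ) ∧
      X ^ 2 * ∏ i ∈ O, (X ^ 2 + X + C (u i)) = X ^ (2 * O.card + 2) +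
        C (O.card : B) * X ^ (2 * O.card + 1) +
        C ((O.card.choose 2 : B) + ∑ i ∈ O, u i) * X ^ (2 * O.card) + R := by
  classical
  induction O using Finset.induction_on with
  | empty => exact ⟨0, by simp⟩
  | insert i O hi ih =>
    obtain ⟨R, hR, h⟩ := ih
    set d := O.card with hd
    refine ⟨(C ((d.choose 2 : B) + ∑ i ∈ O, u i) + C (d : B) * C (u i)) * X ^ (2 * d + 1) +
      C ((d.choose 2 : B) + ∑ i ∈ O, u i) * C (u i) * X ^ (2 * d) + R * (X ^ 2 + X + C (u i)),
      ?_, ?_⟩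
    · rw [Finset.card_insert_of_notMem hi, ← hd, ← C_mul, ← C_add, ← C_mul]
      refine (degree_add_le _ _).trans_lt (max_lt ((degree_add_le _ _).trans_lt (max_lt ?_ ?_)) ?_)
      · exact (degree_C_mul_X_pow_le _ _).trans_lt (by exact_mod_cast (by omega))
      · exact (degree_C_mul_X_pow_le _ _).trans_lt (by exact_mod_cast (by omega))
      · have h2 : (X ^ 2 + X + C (u i)).degree ≤ ((2 : ℕ) : WithBot ℕ) := by
          have h3 : (C (1 : B) * X ^ 2 + C 1 * X + C (u i)).degree ≤ 2 := degree_quadratic_le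
          simpa using h3
        by_cases hR0 : R = 0
        · rw [hR0, zero_mul, degree_zero]
          exact WithBot.bot_lt_coe _
        · rw [degree_eq_natDegree hR0, Nat.cast_lt] at hR
          refine (degree_mul_le _ _).trans_lt ((add_le_add degree_le_natDegree h2).trans_lt ?_)
          exact_mod_cast (by omega)
    · rw [Finset.prod_insert hi, mul_left_comm, h, Finset.card_insert_of_notMem hi, ← hd,
        Finset.sum_insert hi, Nat.choose_succ_succ' d 1, Nat.choose_one_right]
      simp only [Nat.cast_add, map_add, Nat.cast_one, map_one]
      ring

namespace IsRootCover

variable {K B G ι : Type*} [Field K] [CommRing B] [Algebra K B] [Group G]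
  [MulSemiringAction G B] [Fintype ι] {E : K[X]} {T : B} {y : ι → B}
  [SMulCommClass G K B]

theorem eq_one_of_smul_y [FaithfulSMul G B] (h : IsRootCover G E T y) {g : G}
    (hg : ∀ i, g • y i = y i) : g = 1 := by
  apply FaithfulSMul.eq_of_smul_eq_smul (α := B)
  intro b
  have h2 : MulSemiringAction.toAlgHom K B g = AlgHom.id K B := by
    apply AlgHom.ext_of_adjoin_eq_top h.adjoin_eq
    rintro _ ⟨i, rfl⟩
    exact hg i
  rw [one_smul]
  exact congrArg (fun φ : B →ₐ[K] B => φ b) h2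

variable [IsDomain B] [Nonempty ι] [Fintype G] [MulAction G ι]

/-- Distinct roots which collide at some point are exchanged by a reflection, if all critical points
of `E` are simple and only the critical values at `r` and `r + 1` coincide. -/
theorem hasReflection_of_collision [FaithfulSMul G B] (h : IsRootCover G E T y)
    (hy : ∀ (g : G) i, y (g • i) = g • y i) {f : ι → ι} (hfy : ∀ i, y (f i) = y i + 1)
    (hE3 : ∀ r, (derivative E).IsRoot r → ¬ (X - C r) ^ 3 ∣ E - C (eval r E))
    (hE2 : ∀ r r', (derivative E).IsRoot r → (derivative E).IsRoot r' → eval r E = eval r' E →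
      r' = r ∨ r' = r + 1)
    (χ : B →ₐ[K] K) {i j : ι} (hij : j ≠ i) (hχ : χ (y i) = χ (y j)) :
    HasReflection G f i j := by
  classical
  have hcrit : ∀ k l, k ≠ l → χ (y k) = χ (y l) → (X - C (χ (y k))) ^ 2 ∣ E - C (χ T) := by
    intro k l hkl hχ
    rw [← h.prod_map χ, ← Finset.mul_prod_erase _ _ (Finset.mem_univ k),
      ← Finset.mul_prod_erase _ _ (Finset.mem_erase.2 ⟨hkl.symm, Finset.mem_univ l⟩),
      sq, ← mul_assoc, ← hχ]
    exact Dvd.intro _ rfl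
  have hroot : ∀ k l, k ≠ l → χ (y k) = χ (y l) → (derivative E).IsRoot (χ (y k)) := by
    intro k l hkl hχ
    obtain ⟨c, hc⟩ := hcrit k l hkl hχ
    have h2 := congrArg (fun p => eval (χ (y k)) (derivative p)) hc
    simpa [derivative_mul, derivative_pow] using h2
  have hthree : ∀ k l n, k ≠ l → k ≠ n → l ≠ n → χ (y k) = χ (y l) → χ (y k) = χ (y n) →
      False := by
    intro k l n hkl hkn hln h1 h2
    refine hE3 _ (hroot k l hkl h1) ?_
    rw [h.eval_map, ← h.prod_map χ, ← Finset.mul_prod_erase _ _ (Finset.mem_univ k),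
      ← Finset.mul_prod_erase _ _ (Finset.mem_erase.2 ⟨hkl.symm, Finset.mem_univ l⟩),
      ← Finset.mul_prod_erase _ _ (Finset.mem_erase.2 ⟨hln.symm,
        Finset.mem_erase.2 ⟨hkn.symm, Finset.mem_univ n⟩⟩), ← h1, ← h2]
    exact ⟨∏ x ∈ ((Finset.univ.erase k).erase l).erase n, (X - C (χ (y x))), by ring⟩
  have hfχ : ∀ k, χ (y (f k)) = χ (y k) + 1 := fun k => by rw [hfy, map_add, map_one]
  have hfinj : Function.Injective f := fun k l hkl => h.inj (by
    have := congrArg y hkl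
    rwa [hfy, hfy, add_left_inj] at this)
  obtain ⟨g, hg1, hg⟩ := h.exists_compSMul_eq_self χ (by
    obtain ⟨c, hc⟩ := hcrit i j hij.symm hχ
    have h1 := congrArg (aeval (y i)) hc
    simp only [map_sub, h.aeval_y, aeval_C, map_mul, map_pow, aeval_X] at h1
    rw [h1]
    exact Ideal.mul_mem_right _ _ (Ideal.pow_mem_pow (by simp [RingHom.mem_ker]) 2))
  have hgχ : ∀ k, χ (y k) = χ (y (g • k)) := fun k => by
    rw [hy, ← AlgHom.compSMul_apply, hg]
  have hfg : ∀ k, g • f k = f (g • k) := fun k => h.inj (by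
    rw [hy, hfy, hfy, smul_add, smul_one, hy])
  have hfix : ∀ k, k ≠ i → k ≠ j → k ≠ f i → k ≠ f j → g • k = k := by
    intro k h1 h2 h3 h4
    by_contra hk
    rcases hE2 _ _ (hroot i j hij.symm hχ) (hroot k (g • k) (Ne.symm hk) (hgχ k))
      (by rw [h.eval_map, h.eval_map]) with h5 | h5
    · exact hthree i j k hij.symm h1.symm h2.symm hχ h5.symm
    · exact hthree (f i) (f j) k (fun e => hij (hfinj e).symm) h3.symm h4.symm
        (by rw [hfχ, hfχ, hχ]) (by rw [hfχ, h5])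
  have hgi : g • i = i ∨ g • i = j := by
    by_contra! hn
    exact hthree i j (g • i) hij.symm hn.1.symm hn.2.symm hχ (hgχ i)
  have hgj : g • j = i ∨ g • j = j := by
    by_contra! hn
    exact hthree i j (g • j) hij.symm hn.1.symm hn.2.symm hχ (hχ.trans (hgχ j))
  have hinj := MulAction.injective (β := ι) g
  rcases hgi with hgi | hgi
  · exfalso
    have hgj : g • j = j := hgj.resolve_left fun e => hij (hinj (e.trans hgi.symm))
    apply hg1
    refine h.eq_one_of_smul_y fun k => ?_
    rw [← hy]
    congr 1
    by_cases h1 : k = i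
    · rw [h1, hgi]
    by_cases h2 : k = j
    · rw [h2, hgj]
    by_cases h3 : k = f i
    · rw [h3, hfg, hgi]
    by_cases h4 : k = f j
    · rw [h4, hfg, hgj]
    exact hfix k h1 h2 h3 h4
  · exact ⟨g, hgi, hgj.resolve_right fun e => hij (hinj (e.trans hgi.symm)), hfix⟩

omit [SMulCommClass G K B] [Nonempty ι] [Fintype G] [MulAction G ι] in
/-- The sum of the roots in a set of representatives for translation by `1` is a constant. -/
theorem sum_section [CharP K 2] (h : IsRootCover G E T y) {f : ι → ι}
    (hff : ∀ i, f (f i) = i) (hfy : ∀ i, y (f i) = y i + 1) {d : ℕ} (hd : Fintype.card ι = 2 * d)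
    (hd2 : 2 ≤ d) {w : K} (hw : w ^ 2 + w = E.coeff (Fintype.card ι - 2) + d.choose 2)
    {O : Finset ι} (hO : ∀ k, k ∈ O ↔ f k ∉ O) :
    O.card = d ∧ (∑ k ∈ O, y k = algebraMap K B w ∨ ∑ k ∈ O, y k = algebraMap K B (w + 1)) := by
  classical
  have : CharP B 2 := charP_of_injective_algebraMap (algebraMap K B).injective 2
  have hcompl : Oᶜ = O.image f := by
    ext k
    rw [Finset.mem_compl, Finset.mem_image]
    constructor
    · intro hk
      refine ⟨f k, ?_, hff k⟩
      by_contra hk'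
      exact hk ((hO k).2 hk')
    · rintro ⟨l, hl, rfl⟩
      exact (hO l).1 hl
  have hfinj : Function.Injective f := fun k l hkl => by rw [← hff k, hkl, hff]
  have hcard : O.card = d := by
    have h1 := congrArg Finset.card hcompl
    rw [Finset.card_compl, Finset.card_image_of_injective _ hfinj, hd] at h1
    have := Finset.card_le_univ O
    omega
  refine ⟨hcard, ?_⟩
  have hprod : ∏ i, (X - C (y i)) = ∏ i ∈ O, (X ^ 2 + X + C (y i ^ 2 + y i)) := by
    rw [← Finset.prod_mul_prod_compl O, hcompl, Finset.prod_image hfinj.injOn,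
      ← Finset.prod_mul_distrib]
    refine Finset.prod_congr rfl fun i _ => ?_
    rw [hfy, C_add, C_add, C_pow, C_1]
    linear_combination (-X * C (y i) - X) * CharTwo.two_eq_zero (R := B[X])
  obtain ⟨R, hR, hR2⟩ := coeff_prod_pairs (fun i => y i ^ 2 + y i) O
  rw [← hprod, h.prod_eq, hcard] at hR2
  have h1 := congrArg (fun p => coeff p (2 * d)) hR2
  obtain ⟨d', rfl⟩ : ∃ d', d = d' + 2 := ⟨d - 2, by omega⟩
  have e1 : 2 * (d' + 2) = (2 * d' + 2) + 2 := by ring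
  rw [hcard] at hR
  simp only [coeff_add, coeff_C_mul, coeff_X_pow, coeff_eq_zero_of_degree_lt hR] at h1
  rw [e1, mul_comm (X ^ 2), coeff_mul_X_pow, coeff_sub, coeff_C, if_neg (by omega), coeff_map,
    if_neg (by omega), if_neg (by omega), if_pos trivial] at h1
  rw [hd, e1, Nat.add_sub_cancel] at hw
  set S := ∑ k ∈ O, y k with hS
  have h2 : ∑ k ∈ O, (y k ^ 2 + y k) = S ^ 2 + S := by
    rw [Finset.sum_add_distrib, hS, CharTwo.sum_sq]
  have h3 := congrArg (algebraMap K B) hw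
  rw [h2] at h1
  simp only [map_add, map_pow, map_natCast] at h3
  have h4 : (S - algebraMap K B w) * (S - algebraMap K B (w + 1)) = 0 := by
    rw [map_add, map_one]
    linear_combination h3 - h1 + (algebraMap K B (E.coeff (2 * d' + 2)) - S
      - S * algebraMap K B w) * CharTwo.two_eq_zero (R := B)
  rcases mul_eq_zero.1 h4 with h5 | h5
  · exact Or.inl (sub_eq_zero.1 h5)
  · exact Or.inr (sub_eq_zero.1 h5)

end IsRootCover

namespace IsRootCover

variable {K B G ι : Type*} [Field K] [CommRing B] [Algebra K B] [Group G]
  [MulSemiringAction G B] [Fintype ι] {E : K[X]} {T : B} {y : ι → B}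
  [SMulCommClass G K B] [IsDomain B] [Nonempty ι] [Fintype G] [IsAlgClosed K] [MulAction G ι]

/-- The Galois group contains all products of two transpositions `(i, f i)`. -/
theorem hasFlip_and_hasReflection [CharP K 2] [FaithfulSMul G B] (h : IsRootCover G E T y)
    (hy : ∀ (g : G) i, y (g • i) = g • y i) {f : ι → ι} (hff : ∀ i, f (f i) = i)
    (hfy : ∀ i, y (f i) = y i + 1)
    (hE3 : ∀ r, (derivative E).IsRoot r → ¬ (X - C r) ^ 3 ∣ E - C (eval r E))
    (hE2 : ∀ r r', (derivative E).IsRoot r → (derivative E).IsRoot r' → eval r E = eval r' E →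
      r' = r ∨ r' = r + 1)
    {d : ℕ} (hd : Fintype.card ι = 2 * d) (hd2 : 2 ≤ d) (hodd : Odd d)
    {w : K} (hw : w ^ 2 + w = E.coeff (Fintype.card ι - 2) + d.choose 2)
    {i j : ι} (hij : j ≠ i) (hij' : j ≠ f i) : HasFlip G f i j ∧ HasReflection G f i j := by
  classical
  have : CharP B 2 := charP_of_injective_algebraMap (algebraMap K B).injective 2
  have := h.isPretransitive hy
  have hf : ∀ i, f i ≠ i := fun i hi => by
    have := hfy i
    rw [hi] at this
    exact one_ne_zero (left_eq_add.1 this)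
  have hfg : ∀ (g : G) k, f (g • k) = g • f k := fun g k => h.inj (by
    rw [hy, hfy, hfy, smul_add, smul_one, hy])
  have hall := h.rel_of_collisions hy (reflectionSetoid G f hff hfg)
    (fun g i j => reflectionSetoid_smul hff hfg g)
    (fun χ i j hχ => by
      by_cases hij : j = i
      · exact Or.inl hij
      · exact Or.inr (Or.inr (Or.inl (h.hasReflection_of_collision hy hfy hE3 hE2 χ hij hχ))))
    f hf hff (fun i => Or.inr (Or.inl rfl)) (by
      obtain ⟨c, rfl⟩ := hodd
      omega)
  by_cases hno : ∀ i j, j ≠ i → j ≠ f i → ¬ HasFlip G f i j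
  · exfalso
    obtain ⟨O, hO, -, g, hg⟩ := exists_section_of_no_flip hff hfg hf hall hno
    obtain ⟨hcard, hsum⟩ := h.sum_section hff hfy hd hd2 hw hO
    have hinj : Function.Injective fun k => f (g • k) := fun a b hab => by
      have := congrArg f hab
      simp only [hff] at this
      exact MulAction.injective g this
    have himg : O.image (fun k => f (g • k)) = O :=
      Finset.eq_of_subset_of_card_le (Finset.image_subset_iff.2 hg)
        (Finset.card_image_of_injective _ hinj).ge
    have h1 : ∑ k ∈ O, y k = g • ∑ k ∈ O, y k + 1 := by
      conv_lhs => rw [← himg, Finset.sum_image hinj.injOn]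
      simp only [hfy, hy]
      rw [Finset.sum_add_distrib, Finset.smul_sum, Finset.sum_const, hcard, nsmul_one]
      obtain ⟨c, rfl⟩ := hodd
      rw [Nat.cast_add, Nat.cast_mul, Nat.cast_two, CharTwo.two_eq_zero, zero_mul, zero_add,
        Nat.cast_one]
    have h2 : g • ∑ k ∈ O, y k = ∑ k ∈ O, y k := by
      rcases hsum with hs | hs <;> rw [hs, smul_algebraMap]
    rw [h2] at h1
    exact one_ne_zero (left_eq_add.1 h1)
  · push Not at hno
    obtain ⟨a, b, hab, hab', hflip⟩ := hno
    exact hflip.all hff hfg hall hab hab' hij hij'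

/-- A Frobenius lift can be corrected by an element of the Galois group so as to fix all roots. -/
theorem exists_smul_eq_of_semilinear [CharP K 2] [FaithfulSMul G B] (h : IsRootCover G E T y)
    (hy : ∀ (g : G) i, y (g • i) = g • y i)
    (hEc : E.comp (X + 1) = E)
    (hE3 : ∀ r, (derivative E).IsRoot r → ¬ (X - C r) ^ 3 ∣ E - C (eval r E))
    (hE2 : ∀ r r', (derivative E).IsRoot r → (derivative E).IsRoot r' → eval r E = eval r' E →
      r' = r ∨ r' = r + 1)
    {d : ℕ} (hd : Fintype.card ι = 2 * d) (hd2 : 2 ≤ d) (hodd : Odd d)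
    {w : K} (hw : w ^ 2 + w = E.coeff (Fintype.card ι - 2) + d.choose 2)
    {τ : B →+* B} (hτ : Function.Injective τ) {σ : K → K}
    (hσ : ∀ c, τ (algebraMap K B c) = algebraMap K B (σ c)) (hσw : σ w = w)
    (hτy : ∀ i, ∃ j, τ (y i) = y j) : ∃ g : G, ∀ i, g • τ (y i) = y i := by
  classical
  have : CharP B 2 := charP_of_injective_algebraMap (algebraMap K B).injective 2
  have hex : ∀ i, ∃ j, y j = y i + 1 := fun i => by
    obtain ⟨j, hj⟩ := h.exists_eq_y (b := y i + 1) (by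
      rw [← h.aeval_y i]
      conv_rhs => rw [← hEc, aeval_comp]
      simp)
    exact ⟨j, hj.symm⟩
  choose f hfy using hex
  have hff : ∀ i, f (f i) = i := fun i => h.inj (by
    rw [hfy, hfy, add_assoc, CharTwo.add_self_eq_zero, add_zero])
  have hf : ∀ i, f i ≠ i := fun i hi => by
    have := hfy i
    rw [hi] at this
    exact one_ne_zero (left_eq_add.1 this)
  have hfg : ∀ (g : G) k, f (g • k) = g • f k := fun g k => h.inj (by
    rw [hy, hfy, hfy, smul_add, smul_one, hy])
  choose π hπ using hτy
  have hπinj : Function.Injective π := fun a b hab => h.inj (hτ (by rw [hπ, hπ, hab]))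
  have hπf : ∀ i, π (f i) = f (π i) := fun i => h.inj (by
    rw [← hπ, hfy, hfy, map_add, map_one, hπ])
  obtain ⟨g, hg | ⟨i, hi, hg⟩⟩ := exists_smul_fix hff hfg
    (fun i j hij hij' => h.hasFlip_and_hasReflection hy hff hfy hE3 hE2 hd hd2 hodd hw hij hij')
    π hπinj hπf
  · exact ⟨g, fun i => by rw [hπ, ← hy, hg]⟩
  · exfalso
    obtain ⟨O, hO, hiO⟩ := exists_section hff hf i
    have hfi : f i ∉ O := (hO i).1 hiO
    have hsum := (h.sum_section hff hfy hd hd2 hw hO).2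
    have h1 : g • τ (∑ k ∈ O, y k) = ∑ k ∈ O, y k + 1 := by
      rw [map_sum, Finset.smul_sum, ← Finset.add_sum_erase _ _ hiO,
        ← Finset.add_sum_erase _ _ hiO, hπ, ← hy, hi, hfy]
      have : ∑ x ∈ O.erase i, g • τ (y x) = ∑ x ∈ O.erase i, y x := by
        refine Finset.sum_congr rfl fun k hk => ?_
        rw [Finset.mem_erase] at hk
        rw [hπ, ← hy, hg k hk.1 fun e => hfi (e ▸ hk.2)]
      rw [this]
      ring
    have h2 : g • τ (∑ k ∈ O, y k) = ∑ k ∈ O, y k := by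
      rcases hsum with hs | hs
      · rw [hs, hσ, hσw, smul_algebraMap]
      · rw [hs, map_add, map_one, map_add, map_one, hσ, hσw, smul_add, smul_one, smul_algebraMap]
    rw [h2] at h1
    exact one_ne_zero (left_eq_add.1 h1)

end IsRootCover

namespace RootCover

variable {K F Ω : Type*} [Field K] [Field F] [Field Ω] [Algebra K[X] F] [IsFractionRing K[X] F]
  [Algebra F Ω] [Algebra K[X] Ω] [IsScalarTower K[X] F Ω] [Algebra K Ω] [IsScalarTower K K[X] Ω]

/-- The polynomial `E - T` over the rational function field `F = K(T)`. -/
noncomputable def shifted (F : Type*) {K : Type*} [Field K] [Field F] [Algebra K[X] F] (E : K[X]) :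
    F[X] :=
  (E.map C - C X : K[X][X]).map (algebraMap K[X] F)

omit [IsFractionRing K[X] F] in
theorem map_shifted (E : K[X]) : (shifted F E).map (algebraMap F Ω) =
    E.map (algebraMap K Ω) - C (algebraMap K[X] Ω X) := by
  rw [shifted, Polynomial.map_map, ← IsScalarTower.algebraMap_eq, Polynomial.map_sub,
    Polynomial.map_map, map_C, ← algebraMap_eq, ← IsScalarTower.algebraMap_eq]

theorem monic_sub {E : K[X]} (hE : E.Monic) (hE0 : 0 < E.natDegree) {R : Type*} [CommRing R]
    [Nontrivial R] (f : K →+* R) (t : R) : (E.map f - C t).Monic := by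
  refine (hE.map f).sub_of_left ?_
  rw [degree_map_eq_of_leadingCoeff_ne_zero _ (by simp [hE.leadingCoeff])]
  exact degree_C_le.trans_lt (natDegree_pos_iff_degree_pos.1 hE0)

omit [Algebra K Ω] [IsScalarTower K K[X] Ω] in
theorem injective_algebraMap (F : Type*) [Field F] [Algebra K[X] F] [IsFractionRing K[X] F]
    [Algebra F Ω] [IsScalarTower K[X] F Ω] : Function.Injective (algebraMap K[X] Ω) := by
  rw [IsScalarTower.algebraMap_eq K[X] F Ω]
  exact (algebraMap F Ω).injective.comp (IsFractionRing.injective K[X] F)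

omit [IsFractionRing K[X] F] in
theorem mem_rootSet_iff {E : K[X]} (hE : E.Monic) (hE0 : 0 < E.natDegree) {z : Ω} :
    z ∈ (shifted F E).rootSet Ω ↔ aeval z E = algebraMap K[X] Ω X := by
  rw [mem_rootSet', map_shifted, aeval_def, ← eval_map, map_shifted, eval_sub, eval_C,
    eval_map_algebraMap, sub_eq_zero]
  exact and_iff_right (monic_sub hE hE0 _ _).ne_zero

theorem aeval_algebraMap_X (a : K[X]) : aeval (algebraMap K[X] Ω X) a = algebraMap K[X] Ω a := by
  rw [aeval_algebraMap_apply, aeval_X_left_apply]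

theorem not_isAlgebraic (F : Type*) [Field F] [Algebra K[X] F] [IsFractionRing K[X] F]
    [Algebra F Ω] [IsScalarTower K[X] F Ω] : ¬ IsAlgebraic K (algebraMap K[X] Ω X) := by
  rintro ⟨a, ha, ha2⟩
  rw [aeval_algebraMap_X] at ha2
  exact ha ((injective_iff_map_eq_zero _).1 (injective_algebraMap F) a ha2)

theorem nodup_roots {E : K[X]} (hE : E.Monic) (hE0 : 0 < E.natDegree) (hE' : derivative E ≠ 0) :
    ((shifted F E).aroots Ω).Nodup := by
  classical
  rw [Multiset.nodup_iff_count_le_one]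
  intro z
  rw [count_roots, map_shifted]
  by_contra! hz
  rw [one_lt_rootMultiplicity_iff_isRoot (monic_sub hE hE0 _ _).ne_zero, derivative_sub,
    derivative_C, sub_zero, derivative_map, IsRoot, IsRoot, eval_map_algebraMap, eval_sub, eval_C,
    eval_map_algebraMap, sub_eq_zero] at hz
  have h1 : IsAlgebraic K z := ⟨_, hE', hz.2⟩
  have h2 : IsIntegral K (aeval z E) :=
    adjoin_le_integralClosure h1.isIntegral (aeval_mem_adjoin_singleton K z)
  exact not_isAlgebraic F (hz.1 ▸ h2.isAlgebraic)

end RootCover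

theorem Valuation.map_aeval_le {K Ω Γ : Type*} [Field K] [Field Ω] [Algebra K Ω]
    [LinearOrderedCommGroupWithZero Γ] (v : Valuation Ω Γ) (hv : ∀ c : K, v (algebraMap K Ω c) ≤ 1)
    {x : Ω} {γ : Γ} (hγ : 1 ≤ γ) (hx : v x ≤ γ) {p : K[X]} {N : ℕ} (hp : p.natDegree ≤ N) :
    v (aeval x p) ≤ γ ^ N := by
  rw [aeval_eq_sum_range]
  refine v.map_sum_le fun i hi => ?_
  rw [Algebra.smul_def, map_mul, map_pow]
  rw [Finset.mem_range] at hi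
  calc v (algebraMap K Ω (p.coeff i)) * v x ^ i ≤ 1 * γ ^ i :=
        mul_le_mul' (hv _) (pow_le_pow_left' hx i)
    _ ≤ γ ^ N := by
        rw [one_mul]
        exact pow_le_pow_right₀ hγ (by omega)

theorem Valuation.map_aeval_eq {K Ω Γ : Type*} [Field K] [Field Ω] [Algebra K Ω]
    [LinearOrderedCommGroupWithZero Γ] (v : Valuation Ω Γ) (hv : ∀ c : K, v (algebraMap K Ω c) ≤ 1)
    {x : Ω} (hx : 1 < v x) {p : K[X]} (hp : p ≠ 0) : v (aeval x p) = v x ^ p.natDegree := by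
  have hv1 : ∀ c : K, c ≠ 0 → v (algebraMap K Ω c) = 1 := fun c hc => by
    refine le_antisymm (hv c) ?_
    have h1 := hv c⁻¹
    rw [map_inv₀, map_inv₀] at h1
    have h2 : 0 < v (algebraMap K Ω c) := by
      rw [zero_lt_iff, Ne, v.zero_iff]
      simpa using hc
    exact (inv_le_one₀ h2).1 h1
  have hlead : v (algebraMap K Ω p.leadingCoeff * x ^ p.natDegree) = v x ^ p.natDegree := by
    rw [map_mul, map_pow, hv1 _ (leadingCoeff_ne_zero.2 hp), one_mul]
  conv_lhs => rw [← eraseLead_add_C_mul_X_pow p]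
  rw [map_add, map_mul, aeval_C, map_pow, aeval_X]
  rcases Nat.eq_zero_or_pos p.natDegree with h0 | h0
  · rw [eq_C_of_natDegree_eq_zero h0, eraseLead_C, map_zero, zero_add]
    rw [eq_C_of_natDegree_eq_zero h0] at hlead
    exact hlead
  · rw [v.map_add_eq_of_lt_right, hlead]
    rw [hlead]
    exact (v.map_aeval_le hv hx.le le_rfl (eraseLead_natDegree_le p)).trans_lt
      (pow_lt_pow_right₀ hx (by omega))

open scoped Pointwise in
theorem Valuation.map_le_of_mem_span_pow {K Ω Γ : Type*} [Field K] [Field Ω] [Algebra K Ω]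
    [LinearOrderedCommGroupWithZero Γ] (v : Valuation Ω Γ) (hv : ∀ c : K, v (algebraMap K Ω c) ≤ 1)
    {S : Set Ω} {γ : Γ} (hS : ∀ s ∈ S, v s ≤ γ) {M : ℕ} {b : Ω}
    (hb : b ∈ Submodule.span K S ^ M) : v b ≤ γ ^ M := by
  rw [Submodule.span_pow] at hb
  induction hb using Submodule.span_induction with
  | mem x hx =>
    induction M generalizing x with
    | zero => simp_all
    | succ M ih =>
      rw [pow_succ] at hx
      obtain ⟨a, ha, s, hs, rfl⟩ := Set.mem_mul.1 hx
      rw [map_mul, pow_succ]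
      exact mul_le_mul' (ih a ha) (hS s hs)
  | zero => simp
  | add x y _ _ hx hy => exact (v.map_add_le hx hy)
  | smul c x _ hx =>
    rw [Algebra.smul_def, map_mul]
    exact (mul_le_mul' (hv c) hx).trans (one_mul _).le

/-- A transcendental element is not integral at some valuation which is trivial on constants. -/
theorem exists_valuation_of_not_isAlgebraic {K Ω : Type*} [Field K] [Field Ω] [Algebra K Ω]
    [IsAlgClosed K] {x : Ω} (hx : ¬ IsAlgebraic K x) :
    ∃ V : ValuationSubring Ω, (∀ c : K, V.valuation (algebraMap K Ω c) ≤ 1) ∧ 1 < V.valuation x := by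
  let R : Subring Ω := (algebraMap K Ω).range
  have hR : IsIntegrallyClosedIn R Ω := by
    rw [isIntegrallyClosedIn_iff]
    refine ⟨Subtype.val_injective, fun {z} hz => ?_⟩
    have h1 : IsIntegral K z := by
      obtain ⟨p, hp, hp2⟩ := hz
      obtain ⟨q, hq, -, hq2⟩ := lifts_and_natDegree_eq_and_monic (p := p)
        (f := (algebraMap K Ω).rangeRestrict)
        ((lifts_iff_coeff_lifts _).2 fun n => RingHom.rangeRestrict_surjective _ _) hp
      refine ⟨q, hq2, ?_⟩
      rw [← hp2, ← hq, eval₂_map]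
      rfl
    obtain ⟨c, hc⟩ := minpoly.mem_range_of_degree_eq_one K z
      (IsAlgClosed.degree_eq_one_of_irreducible K (minpoly.irreducible h1))
    exact ⟨⟨z, c, hc⟩, rfl⟩
  have hxR : x ∉ R := by
    rintro ⟨c, rfl⟩
    exact hx (isAlgebraic_algebraMap c)
  obtain ⟨V, hV, hV2⟩ := Subring.exists_le_valuationSubring_of_isIntegrallyClosedIn hxR
  refine ⟨V, fun c => (V.valuation_le_one_iff _).2 (hV ⟨c, rfl⟩), ?_⟩
  rw [← not_le, V.valuation_le_one_iff]
  exact hV2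

namespace RootCover

variable {K F Ω : Type*} [Field K] [Field F] [Field Ω] [Algebra K[X] F] [IsFractionRing K[X] F]
  [Algebra F Ω] [Algebra K[X] Ω] [IsScalarTower K[X] F Ω] [Algebra K Ω] [IsScalarTower K K[X] Ω]

/-- The `K`-algebra generated by the roots of `E - T`. -/
def rootAlgebra (F : Type*) {K : Type*} (Ω : Type*) [Field K] [Field F] [Field Ω] [Algebra K[X] F]
    [Algebra F Ω] [Algebra K Ω] (E : K[X]) : Subalgebra K Ω :=
  Algebra.adjoin K ((shifted F E).rootSet Ω)

/-- The roots of `E - T` as elements of the algebra they generate. -/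
def rootAlgebra.root (E : K[X]) (z : (shifted F E).rootSet Ω) : rootAlgebra F Ω E :=
  ⟨z, Algebra.subset_adjoin z.2⟩

omit [IsFractionRing K[X] F] [Algebra K Ω] [IsScalarTower K K[X] Ω] in
theorem smul_algebraMap_X (g : Gal(Ω/F)) (a : K[X]) : g (algebraMap K[X] Ω a) =
    algebraMap K[X] Ω a := by
  rw [IsScalarTower.algebraMap_apply K[X] F Ω, g.commutes]

omit [IsFractionRing K[X] F] in
theorem smul_algebraMap' (g : Gal(Ω/F)) (c : K) : g (algebraMap K Ω c) = algebraMap K Ω c := by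
  rw [IsScalarTower.algebraMap_apply K K[X] Ω, smul_algebraMap_X]

omit [IsFractionRing K[X] F] in
theorem map_mem_rootAlgebra {E : K[X]} (g : Gal(Ω/F)) {b : Ω} (hb : b ∈ rootAlgebra F Ω E) :
    g b ∈ rootAlgebra F Ω E := by
  induction hb using Algebra.adjoin_induction with
  | mem x hx => exact Algebra.subset_adjoin (smul_mem_rootSet g hx)
  | algebraMap c =>
    rw [smul_algebraMap']
    exact Subalgebra.algebraMap_mem _ c
  | add x y _ _ hx hy => rw [map_add]; exact add_mem hx hy
  | mul x y _ _ hx hy => rw [map_mul]; exact mul_mem hx hy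

noncomputable instance (E : K[X]) : MulSemiringAction Gal(Ω/F) (rootAlgebra F Ω E) where
  smul g b := ⟨g b, map_mem_rootAlgebra g b.2⟩
  one_smul _ := rfl
  mul_smul _ _ _ := rfl
  smul_zero g := Subtype.ext (map_zero g)
  smul_add g _ _ := Subtype.ext (map_add g _ _)
  smul_one g := Subtype.ext (map_one g)
  smul_mul g _ _ := Subtype.ext (map_mul g _ _)

omit [IsFractionRing K[X] F] in
theorem coe_smul {E : K[X]} (g : Gal(Ω/F)) (b : rootAlgebra F Ω E) :
    ((g • b : rootAlgebra F Ω E) : Ω) = g b := rfl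

instance (E : K[X]) : SMulCommClass Gal(Ω/F) K (rootAlgebra F Ω E) where
  smul_comm g c b := Subtype.ext (by
    rw [coe_smul, Subalgebra.coe_smul, Subalgebra.coe_smul, coe_smul, Algebra.smul_def, map_mul,
      smul_algebraMap', Algebra.smul_def])

omit [IsFractionRing K[X] F] in
theorem root_smul {E : K[X]} (g : Gal(Ω/F)) (z : (shifted F E).rootSet Ω) :
    rootAlgebra.root E (g • z) = g • rootAlgebra.root E z := rfl

omit [IsFractionRing K[X] F] in
theorem nonempty_rootSet {E : K[X]} (hE : E.Monic) (hE0 : 0 < E.natDegree)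
    (hs : ((shifted F E).map (algebraMap F Ω)).Splits) : Nonempty ((shifted F E).rootSet Ω) := by
  have h1 : ((shifted F E).map (algebraMap F Ω)).degree ≠ 0 := by
    rw [map_shifted]
    intro h0
    have h2 := natDegree_eq_zero_iff_degree_le_zero.2 h0.le
    rw [natDegree_sub_C, hE.natDegree_map] at h2
    omega
  obtain ⟨z, hz⟩ := hs.exists_eval_eq_zero h1
  refine ⟨z, mem_rootSet'.2 ⟨?_, by rwa [eval_map_algebraMap] at hz⟩⟩
  rw [map_shifted]
  exact (monic_sub hE hE0 _ _).ne_zero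

omit [IsFractionRing K[X] F] in
theorem algebraMap_X_mem {E : K[X]} (hE : E.Monic) (hE0 : 0 < E.natDegree)
    (hs : ((shifted F E).map (algebraMap F Ω)).Splits) :
    algebraMap K[X] Ω X ∈ rootAlgebra F Ω E := by
  obtain ⟨z⟩ := nonempty_rootSet hE hE0 hs
  rw [← (mem_rootSet_iff hE hE0).1 z.2]
  have h1 := Subalgebra.aeval_coe _ (rootAlgebra.root E z) E
  rw [show (rootAlgebra.root E z : Ω) = z from rfl] at h1
  rw [h1]
  exact SetLike.coe_mem _

theorem prod_rootSet {E : K[X]} (hE : E.Monic) (hE0 : 0 < E.natDegree) (hE' : derivative E ≠ 0)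
    (hs : ((shifted F E).map (algebraMap F Ω)).Splits) :
    ∏ z : (shifted F E).rootSet Ω, (X - C (z : Ω)) =
      E.map (algebraMap K Ω) - C (algebraMap K[X] Ω X) := by
  classical
  have hm : ((shifted F E).map (algebraMap F Ω)).Monic := by
    rw [map_shifted]
    exact monic_sub hE hE0 _ _
  rw [← map_shifted (F := F), hs.eq_prod_roots_of_monic hm]
  have h1 : ∏ z : (shifted F E).rootSet Ω, (X - C (z : Ω)) =
      ∏ z ∈ ((shifted F E).aroots Ω).toFinset, (X - C z) := by
    exact (Finset.prod_subtype ((shifted F E).aroots Ω).toFinset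
      (p := (· ∈ (shifted F E).rootSet Ω)) (fun z => by rw [rootSet_def, Finset.mem_coe])
      fun z => X - C z).symm
  rw [h1, Finset.prod, Multiset.toFinset_val, (nodup_roots hE hE0 hE').dedup]

theorem natDegree_eq_card {E : K[X]} (hE : E.Monic) (hE0 : 0 < E.natDegree)
    (hE' : derivative E ≠ 0) (hs : ((shifted F E).map (algebraMap F Ω)).Splits) :
    Fintype.card ((shifted F E).rootSet Ω) = E.natDegree := by
  have h1 := congrArg natDegree (prod_rootSet hE hE0 hE' hs)
  rw [natDegree_prod_of_monic _ _ fun z _ => monic_X_sub_C _] at h1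
  simpa [natDegree_sub_C, hE.natDegree_map] using h1

theorem deg_le [IsAlgClosed K] {E : K[X]} (hE : E.Monic) (hE0 : 0 < E.natDegree)
    {a : K[X]} {M : ℕ}
    (ha : algebraMap K[X] Ω a ∈ Submodule.span K (insert 1 ((shifted F E).rootSet Ω)) ^ M)
    (hne : Nonempty ((shifted F E).rootSet Ω)) : E.natDegree * a.natDegree ≤ M := by
  obtain ⟨V, hV, hT⟩ := exists_valuation_of_not_isAlgebraic (not_isAlgebraic (K := K) (Ω := Ω) F)
  have hz1 : ∀ z ∈ (shifted F E).rootSet Ω, 1 < V.valuation z := by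
    intro z hz
    by_contra! h1
    have h2 := V.valuation.map_aeval_le hV le_rfl h1 (le_refl E.natDegree)
    rw [(mem_rootSet_iff hE hE0).1 hz, one_pow] at h2
    exact hT.not_ge h2
  have hz2 : ∀ z ∈ (shifted F E).rootSet Ω,
      V.valuation z ^ E.natDegree = V.valuation (algebraMap K[X] Ω X) := fun z hz => by
    rw [← V.valuation.map_aeval_eq hV (hz1 z hz) hE.ne_zero, (mem_rootSet_iff hE hE0).1 hz]
  obtain ⟨z, hz⟩ := hne
  rcases eq_or_ne a 0 with rfl | ha0
  · simp
  have h3 := V.valuation.map_le_of_mem_span_pow hV (γ := V.valuation z) (by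
    rintro s (rfl | hs)
    · rw [map_one]; exact (hz1 z hz).le
    · exact (pow_le_pow_iff_left₀ zero_le zero_le hE0.ne').1
        (by rw [hz2 s hs, hz2 z hz])) ha
  rw [← aeval_algebraMap_X, V.valuation.map_aeval_eq hV hT ha0, ← hz2 z hz, ← pow_mul] at h3
  exact (pow_le_pow_iff_right₀ (hz1 z hz)).1 h3

end RootCover

open scoped Pointwise in
theorem span_pow_eq_top {F Ω : Type*} [Field F] [Field Ω] [Algebra F Ω] [FiniteDimensional F Ω]
    {S : Set Ω} (h1 : 1 ∈ S) (hS : Algebra.adjoin F S = ⊤) :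
    Submodule.span F (S ^ Module.finrank F Ω) = ⊤ := by
  by_contra hcon
  rw [← Submodule.span_pow] at hcon
  set U := Submodule.span F S with hU
  have hU1 : 1 ≤ U := Submodule.one_le.2 (Submodule.subset_span h1)
  have hmono : Monotone fun M : ℕ => U ^ M := pow_right_mono₀ hU1
  have hrank : ∀ M ≤ Module.finrank F Ω, M < Module.finrank F ↥(U ^ M) := by
    intro M hM
    induction M with
    | zero =>
      rw [Module.finrank_pos_iff, pow_zero]
      exact ⟨⟨1, Submodule.one_le.1 le_rfl⟩, 0, fun h => one_ne_zero (congrArg Subtype.val h)⟩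
    | succ M ih =>
      refine Nat.lt_of_le_of_lt (ih (by omega)) (Submodule.finrank_lt_finrank_of_lt ?_)
      refine lt_of_le_of_ne (hmono (Nat.le_succ M)) fun heq => hcon ?_
      rw [eq_top_iff]
      refine le_trans ?_ (hmono (show M ≤ Module.finrank F Ω by omega))
      rw [← Algebra.top_toSubmodule, ← hS, Algebra.adjoin_eq_span, Submodule.span_le]
      intro x hx
      induction hx using Submonoid.closure_induction_left with
      | one => exact (Submodule.one_le.1 (one_le_pow₀ hU1))
      | mul_left s hs x _ hx =>
        change s * x ∈ U ^ M
        rw [heq, pow_succ']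
        exact Submodule.mul_mem_mul (Submodule.subset_span hs) hx
  exact (hrank _ le_rfl).not_ge (Submodule.finrank_le _)

open scoped Pointwise in
/-- Lower bound for the dimension of the filtration on a finite extension of a field containing a
transcendental element `t`. -/
theorem le_finrank_span_pow {K F Ω : Type*} [Field K] [Field F] [Field Ω] [Algebra K F]
    [Algebra F Ω] [Algebra K Ω] [IsScalarTower K F Ω] [FiniteDimensional F Ω]
    {S : Set Ω} (hfin : S.Finite) (h1 : 1 ∈ S) (hS : Algebra.adjoin F S = ⊤) {t : F}
    (ht : Transcendental K t) {e κ : ℕ} (he : 0 < e) (hκ : Module.finrank F Ω = e * κ)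
    (hte : algebraMap F Ω t ∈ Submodule.span K S ^ e) (M : ℕ) :
    κ * (M - Module.finrank F Ω) ≤ Module.finrank K ↥(Submodule.span K S ^ M) := by
  classical
  set D := Module.finrank F Ω with hD
  rcases Nat.lt_or_ge M D with hM | hM
  · rw [Nat.sub_eq_zero_of_le hM.le, mul_zero]
    exact Nat.zero_le _
  obtain ⟨b, hbS, hbspan, hb⟩ := exists_linearIndependent F (S ^ D)
  rw [span_pow_eq_top h1 hS] at hbspan
  have hbcard : Nat.card b = D :=
    (Module.finrank_eq_nat_card_basis (Module.Basis.mk hb (by rw [Subtype.range_coe, hbspan]))).symm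
  have : Finite b := hb.finite
  have := Fintype.ofFinite b
  have hpow : LinearIndependent K fun j : ℕ => t ^ j := by
    have h2 := (basisMonomials K).linearIndependent.map' (aeval t).toLinearMap
      (LinearMap.ker_eq_bot.2 (transcendental_iff_injective.1 ht))
    have h3 : (fun j : ℕ => t ^ j) = (aeval t).toLinearMap ∘ basisMonomials K := by
      ext j
      simp
    rw [h3]
    exact h2
  set q := (M - D) / e with hq
  have hli := linearIndependent_smul (hpow.comp (fun j : Fin (q + 1) => (j : ℕ))
    Fin.val_injective) hb
  have hU1 : 1 ≤ Submodule.span K S := Submodule.one_le.2 (Submodule.subset_span h1)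
  have hmem : ∀ p : Fin (q + 1) × b, t ^ (p.1 : ℕ) • (p.2 : Ω) ∈ Submodule.span K S ^ M := by
    rintro ⟨j, x, hx⟩
    have h3 : algebraMap F Ω t ^ (j : ℕ) * x ∈ Submodule.span K S ^ (e * j + D) := by
      rw [pow_add, pow_mul]
      refine Submodule.mul_mem_mul (Submodule.pow_mem_pow _ hte _) ?_
      rw [Submodule.span_pow]
      exact Submodule.subset_span (hbS hx)
    rw [Algebra.smul_def, map_pow]
    refine pow_right_mono₀ hU1 ?_ h3
    have h4 : (j : ℕ) ≤ q := Nat.lt_succ_iff.1 j.2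
    have h5 : e * j ≤ M - D := (Nat.mul_le_mul_left e h4).trans (Nat.mul_div_le _ _)
    omega
  have : Module.Finite K ↥(Submodule.span K S ^ M) :=
    Module.Finite.iff_fg.2 ((Submodule.fg_span hfin).pow M)
  have hli2 : LinearIndependent K
      fun p : Fin (q + 1) × b => (⟨_, hmem p⟩ : ↥(Submodule.span K S ^ M)) :=
    LinearIndependent.of_comp (Submodule.span K S ^ M).subtype hli
  have hcard := hli2.fintype_card_le_finrank
  rw [Fintype.card_prod, Fintype.card_fin, ← Nat.card_eq_fintype_card, hbcard] at hcard
  refine le_trans ?_ hcard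
  have h6 : M - D ≤ e * (q + 1) := by
    rw [hq]
    exact (Nat.lt_mul_div_succ _ he).le
  calc κ * (M - D) ≤ κ * (e * (q + 1)) := Nat.mul_le_mul_left _ h6
    _ = (q + 1) * D := by rw [hκ]; ring

namespace RootCover

variable {K F Ω : Type*} [Field K] [Field F] [Field Ω] [Algebra K[X] F] [IsFractionRing K[X] F]
  [Algebra F Ω] [Algebra K[X] Ω] [IsScalarTower K[X] F Ω] [Algebra K Ω] [IsScalarTower K K[X] Ω]

theorem isGalois {E : K[X]} (hE : E.Monic) (hE0 : 0 < E.natDegree) (hE' : derivative E ≠ 0)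
    [hs : (shifted F E).IsSplittingField F Ω] : IsGalois F Ω := by
  have h0 : shifted F E ≠ 0 := by
    intro h0
    have h1 := map_shifted (F := F) (Ω := Ω) E
    rw [h0, Polynomial.map_zero] at h1
    exact (monic_sub hE hE0 _ _).ne_zero h1.symm
  exact IsGalois.of_separable_splitting_field
    ((nodup_aroots_iff_of_splits h0 hs.splits).1 (nodup_roots hE hE0 hE'))

omit [IsFractionRing K[X] F] [Algebra K[X] Ω] [IsScalarTower K[X] F Ω] [IsScalarTower K K[X] Ω] in
theorem map_degOneSpan_pow (E : K[X]) (M : ℕ) :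
    (degOneSpan K (rootAlgebra.root (F := F) (Ω := Ω) E) ^ M).map
      (rootAlgebra F Ω E).val.toLinearMap =
    Submodule.span K (insert 1 ((shifted F E).rootSet Ω)) ^ M := by
  rw [Submodule.map_pow, degOneSpan, Submodule.map_span, Set.image_insert_eq]
  congr 3
  ext z
  constructor
  · rintro ⟨_, ⟨w, rfl⟩, rfl⟩
    exact w.2
  · intro hz
    exact ⟨_, ⟨⟨z, hz⟩, rfl⟩, rfl⟩

omit [IsFractionRing K[X] F] in
theorem isIntegral_of_mem {E : K[X]} (hE : E.Monic) (hE0 : 0 < E.natDegree) {b : Ω}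
    (hb : b ∈ rootAlgebra F Ω E) : IsIntegral K[X] b := by
  induction hb using Algebra.adjoin_induction with
  | mem z hz =>
    refine ⟨E.map C - C X, monic_sub hE hE0 _ _, ?_⟩
    rw [eval₂_sub, eval₂_C, eval₂_map, ← algebraMap_eq, ← IsScalarTower.algebraMap_eq, ← aeval_def,
      (mem_rootSet_iff hE hE0).1 hz, sub_self]
  | algebraMap c =>
    rw [IsScalarTower.algebraMap_apply K K[X] Ω]
    exact isIntegral_algebraMap
  | add x y _ _ hx hy => exact hx.add hy
  | mul x y _ _ hx hy => exact hx.mul hy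

theorem isRootCover [IsAlgClosed K] {E : K[X]} (hE : E.Monic) (hE0 : 0 < E.natDegree)
    (hE' : derivative E ≠ 0) [hs : (shifted F E).IsSplittingField F Ω] :
    IsRootCover Gal(Ω/F) E ⟨algebraMap K[X] Ω X, algebraMap_X_mem hE hE0 hs.splits⟩
      (rootAlgebra.root E) := by
  have := isGalois (Ω := Ω) (F := F) hE hE0 hE'
  have := IsSplittingField.finiteDimensional Ω (shifted F E)
  have hT : ∀ a : K[X], ((aeval (⟨algebraMap K[X] Ω X, algebraMap_X_mem hE hE0 hs.splits⟩ :
      rootAlgebra F Ω E) a : rootAlgebra F Ω E) : Ω) = algebraMap K[X] Ω a := fun a => by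
    rw [← Subalgebra.aeval_coe, aeval_algebraMap_X]
  refine ⟨fun a b hab => Subtype.ext (congrArg (fun x : rootAlgebra F Ω E => (x : Ω)) hab), ?_, ?_, ?_, ?_, ?_⟩
  · apply map_injective (rootAlgebra F Ω E).val.toRingHom Subtype.val_injective
    rw [Polynomial.map_prod, Polynomial.map_sub, Polynomial.map_map, map_C]
    simp only [Polynomial.map_sub, map_X, map_C]
    exact prod_rootSet hE hE0 hE' hs.splits
  · have h1 : Algebra.adjoin K ((fun x : rootAlgebra F Ω E => (x : Ω)) ⁻¹'
        (shifted F E).rootSet Ω) = ⊤ := Algebra.adjoin_adjoin_coe_preimage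
    rw [eq_top_iff, ← h1]
    exact Algebra.adjoin_mono fun z hz => ⟨⟨z, hz⟩, rfl⟩
  · intro b hb
    obtain ⟨x, hx⟩ := (IsGalois.mem_range_algebraMap_iff_fixed (F := F) (b : Ω)).2
      fun g => congrArg Subtype.val (hb g)
    have h1 : IsIntegral K[X] x := by
      rw [← isIntegral_algebraMap_iff (algebraMap F Ω).injective, hx]
      exact isIntegral_of_mem hE hE0 b.2
    obtain ⟨a, ha⟩ := IsIntegrallyClosed.isIntegral_iff.1 h1
    refine ⟨a, Subtype.ext ?_⟩
    rw [hT, ← hx, ← ha, ← IsScalarTower.algebraMap_apply]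
  · intro g
    exact Subtype.ext (smul_algebraMap_X g X)
  · intro a M ha
    rw [natDegree_eq_card hE hE0 hE' hs.splits]
    refine deg_le (F := F) hE hE0 ?_ (nonempty_rootSet hE hE0 hs.splits)
    rw [← map_degOneSpan_pow]
    exact ⟨_, ha, hT a⟩

omit [IsFractionRing K[X] F] [Algebra K[X] Ω] [IsScalarTower K[X] F Ω] [Algebra K Ω]
  [IsScalarTower K K[X] Ω] in
theorem eq_one_of_root {E : K[X]} [hs : (shifted F E).IsSplittingField F Ω] {g : Gal(Ω/F)}
    (hg : ∀ z ∈ (shifted F E).rootSet Ω, g z = z) : g = 1 := by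
  have h1 : (g : Ω →ₐ[F] Ω) = AlgHom.id F Ω := AlgHom.ext_of_adjoin_eq_top hs.adjoin_rootSet hg
  ext z
  exact congrArg (fun φ : Ω →ₐ[F] Ω => φ z) h1

omit [IsFractionRing K[X] F] in
theorem faithfulSMul (E : K[X]) [hs : (shifted F E).IsSplittingField F Ω] :
    FaithfulSMul Gal(Ω/F) (rootAlgebra F Ω E) := by
  refine ⟨fun {g h} hgh => ?_⟩
  rw [← inv_mul_eq_one]
  refine eq_one_of_root (E := E) fun z hz => ?_
  have h1 := congrArg (Subtype.val) (hgh (rootAlgebra.root E ⟨z, hz⟩))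
  have h2 : g z = h z := h1
  rw [AlgEquiv.mul_apply, ← h2]
  exact g.symm_apply_apply z

theorem card_le_factorial {E : K[X]} (hE : E.Monic) (hE0 : 0 < E.natDegree)
    (hE' : derivative E ≠ 0) [hs : (shifted F E).IsSplittingField F Ω] [Fintype Gal(Ω/F)] :
    Fintype.card Gal(Ω/F) ≤ E.natDegree.factorial := by
  classical
  rw [← natDegree_eq_card (Ω := Ω) (F := F) hE hE0 hE' hs.splits, ← Fintype.card_perm]
  refine Fintype.card_le_of_injective
    (MulAction.toPermHom Gal(Ω/F) ((shifted F E).rootSet Ω)) ?_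
  rw [injective_iff_map_eq_one]
  intro g hg
  refine eq_one_of_root (E := E) fun z hz => ?_
  exact congrArg Subtype.val (congrArg (fun p : Equiv.Perm ((shifted F E).rootSet Ω) => p ⟨z, hz⟩) hg)

theorem le_finrank_degOneSpan [Algebra K F] [IsScalarTower K K[X] F] {E : K[X]} (hE : E.Monic)
    (hE0 : 0 < E.natDegree) (hE' : derivative E ≠ 0) [hs : (shifted F E).IsSplittingField F Ω]
    [Fintype Gal(Ω/F)] {κ : ℕ} (hκ : Fintype.card Gal(Ω/F) = E.natDegree * κ) (M : ℕ) :
    κ * (M - Fintype.card Gal(Ω/F)) ≤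
      Module.finrank K ↥(degOneSpan K (rootAlgebra.root (F := F) (Ω := Ω) E) ^ M) := by
  have := isGalois (Ω := Ω) (F := F) hE hE0 hE'
  have := IsSplittingField.finiteDimensional Ω (shifted F E)
  have : IsScalarTower K F Ω := IsScalarTower.of_algebraMap_eq fun c => by
    rw [IsScalarTower.algebraMap_apply K K[X] F, ← IsScalarTower.algebraMap_apply K[X] F Ω,
      ← IsScalarTower.algebraMap_apply]
  have hcard : Fintype.card Gal(Ω/F) = Module.finrank F Ω := by
    rw [← Nat.card_eq_fintype_card]
    exact IsGalois.card_aut_eq_finrank F Ω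
  rw [(Submodule.equivMapOfInjective (rootAlgebra F Ω E).val.toLinearMap Subtype.val_injective
    _).finrank_eq, map_degOneSpan_pow, hcard]
  rw [hcard] at hκ
  obtain ⟨z, hz⟩ := nonempty_rootSet hE hE0 hs.splits
  refine le_finrank_span_pow (t := algebraMap K[X] F X) ((Set.toFinite _).insert 1)
    (Set.mem_insert _ _) ?_ ?_ hE0 hκ ?_ M
  · rw [eq_top_iff, ← hs.adjoin_rootSet]
    exact Algebra.adjoin_mono (Set.subset_insert _ _)
  · exact fun h => transcendental_X K
      ((isAlgebraic_algebraMap_iff (IsFractionRing.injective K[X] F)).1 h)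
  · rw [← IsScalarTower.algebraMap_apply, ← (mem_rootSet_iff hE hE0).1 hz, aeval_eq_sum_range]
    refine Submodule.sum_mem _ fun i hi => Submodule.smul_mem _ _ ?_
    have h1 : (1 : Submodule K Ω) ≤ Submodule.span K (insert 1 ((shifted F E).rootSet Ω)) :=
      Submodule.one_le.2 (Submodule.subset_span (Set.mem_insert _ _))
    refine pow_right_mono₀ h1 (Nat.lt_succ_iff.1 (Finset.mem_range.1 hi)) ?_
    exact Submodule.pow_mem_pow _ (Submodule.subset_span (Set.mem_insert_of_mem _ hz)) i

end RootCover

theorem Polynomial.IsSplittingField.exists_ringHom_comp_eq {F L A : Type*} [Field F] [Field L]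
    [Field A] [Algebra F L] (p : F[X]) [IsSplittingField F L p] (φ : F →+* A)
    (h : (p.map φ).Splits) : ∃ ψ : L →+* A, ∀ c, ψ (algebraMap F L c) = φ c := by
  let _ := φ.toAlgebra
  exact ⟨(IsSplittingField.lift L p h : L →ₐ[F] A), fun c => AlgHom.commutes _ c⟩

namespace RootCover

variable {K F Ω : Type*} [Field K] [Field F] [Field Ω] [Algebra K[X] F] [IsFractionRing K[X] F]
  [Algebra F Ω] [Algebra K[X] Ω] [IsScalarTower K[X] F Ω] [Algebra K Ω] [IsScalarTower K K[X] Ω]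

omit [Algebra K Ω] [IsScalarTower K K[X] Ω] in
theorem exists_semilinear (E : K[X]) [hs : (shifted F E).IsSplittingField F Ω] {σ : K →+* K}
    (hσ : E.map σ = E) : ∃ τ : Ω →+* Ω, ∀ a : K[X], τ (algebraMap K[X] Ω a) =
      algebraMap K[X] Ω (a.map σ) := by
  have hg : Function.Injective ((algebraMap K[X] Ω).comp (mapRingHom σ)) :=
    (injective_algebraMap F).comp (map_injective σ σ.injective)
  have h1 : (shifted F E).map (IsFractionRing.lift (K := F) hg) =
      (shifted F E).map (algebraMap F Ω) := by
    have h2 : (IsFractionRing.lift (K := F) hg).comp (algebraMap K[X] F) =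
        (algebraMap K[X] Ω).comp (mapRingHom σ) :=
      RingHom.ext fun a => IsFractionRing.lift_algebraMap hg a
    have h3 : (mapRingHom σ).comp C = (C : K →+* K[X]).comp σ := RingHom.ext fun c => by simp
    rw [shifted, Polynomial.map_map, h2, ← Polynomial.map_map, Polynomial.map_sub,
      Polynomial.map_map, h3, ← Polynomial.map_map, hσ, map_C, coe_mapRingHom, map_X,
      Polynomial.map_map, IsScalarTower.algebraMap_eq K[X] F Ω]
  obtain ⟨τ, hτ⟩ := IsSplittingField.exists_ringHom_comp_eq (L := Ω) (shifted F E)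
    (IsFractionRing.lift (K := F) hg) (h1 ▸ hs.splits)
  refine ⟨τ, fun a => ?_⟩
  rw [IsScalarTower.algebraMap_apply K[X] F Ω, hτ, IsFractionRing.lift_algebraMap]
  rfl

theorem exists_semilinear_rootAlgebra {E : K[X]} (hE : E.Monic) (hE0 : 0 < E.natDegree)
    [hs : (shifted F E).IsSplittingField F Ω] {σ : K →+* K} (hσ : E.map σ = E) :
    ∃ τ : rootAlgebra F Ω E →+* rootAlgebra F Ω E, Function.Injective τ ∧
      (∀ c, τ (algebraMap K _ c) = algebraMap K _ (σ c)) ∧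
      τ ⟨algebraMap K[X] Ω X, algebraMap_X_mem hE hE0 hs.splits⟩ =
        ⟨algebraMap K[X] Ω X, algebraMap_X_mem hE hE0 hs.splits⟩ ∧
      ∀ z, ∃ z', τ (rootAlgebra.root E z) = rootAlgebra.root E z' := by
  obtain ⟨τ, hτ⟩ := exists_semilinear (F := F) (Ω := Ω) E hσ
  have hτK : ∀ c, τ (algebraMap K Ω c) = algebraMap K Ω (σ c) := fun c => by
    rw [IsScalarTower.algebraMap_apply K K[X] Ω, hτ, algebraMap_eq, map_C,
      IsScalarTower.algebraMap_apply K K[X] Ω, algebraMap_eq]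
  have hτX : τ (algebraMap K[X] Ω X) = algebraMap K[X] Ω X := by rw [hτ, map_X]
  have hroot : ∀ z ∈ (shifted F E).rootSet Ω, τ z ∈ (shifted F E).rootSet Ω := by
    intro z hz
    rw [mem_rootSet_iff hE hE0] at hz ⊢
    have h1 : τ.comp (algebraMap K Ω) = (algebraMap K Ω).comp σ := RingHom.ext hτK
    rw [← hτX, ← hz, aeval_def, aeval_def, hom_eval₂, h1, ← eval₂_map, hσ]
  have hmem : ∀ b ∈ rootAlgebra F Ω E, τ b ∈ rootAlgebra F Ω E := by
    intro b hb
    induction hb using Algebra.adjoin_induction with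
    | mem x hx => exact Algebra.subset_adjoin (hroot x hx)
    | algebraMap c =>
      rw [hτK]
      exact Subalgebra.algebraMap_mem _ _
    | add x y _ _ hx hy => rw [map_add]; exact add_mem hx hy
    | mul x y _ _ hx hy => rw [map_mul]; exact mul_mem hx hy
  refine ⟨(τ.comp (rootAlgebra F Ω E).val.toRingHom).codRestrict (rootAlgebra F Ω E)
    fun b => hmem _ b.2, RingHom.injective_codRestrict.2 (τ.injective.comp Subtype.val_injective),
    fun c => Subtype.ext (hτK c), Subtype.ext hτX, fun z => ⟨⟨τ z, hroot z z.2⟩, rfl⟩⟩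

theorem exists_totally_split [Algebra K F] [IsScalarTower K K[X] F] [IsAlgClosed K] [CharP K 2]
    {E : K[X]} [hs : (shifted F E).IsSplittingField F Ω] {d : ℕ}
    (hE : E.Monic) (hdeg : E.natDegree = 2 * d) (hd : 2 ≤ d) (hodd : Odd d)
    (hE' : derivative E ≠ 0) (hEc : E.comp (X + 1) = E)
    (hE3 : ∀ r, (derivative E).IsRoot r → ¬ (X - C r) ^ 3 ∣ E - C (eval r E))
    (hE2 : ∀ r r', (derivative E).IsRoot r → (derivative E).IsRoot r' → eval r E = eval r' E →
      r' = r ∨ r' = r + 1)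
    {w : K} (hw : w ^ 2 + w = E.coeff (2 * d - 2) + d.choose 2) {σ : K →+* K} (hσ : E.map σ = E)
    (hσw : σ w = w) {n : ℕ} (hσq : ∀ c, σ c ^ 2 ^ n = c) (R : Finset K) (hR : R.card = 2 ^ n)
    (hRn : ∀ t ∈ R, t ^ 2 ^ n = t) (hn : 10 * ((2 * d).factorial + 2) ^ 4 ≤ 2 ^ (n / 2)) :
    ∃ t : K, t ^ 2 ^ n = t ∧ ∃ s : Finset K, s.card = 2 * d ∧
      ∀ r ∈ s, eval r E = t ∧ r ^ 2 ^ n = r := by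
  classical
  have hE0 : 0 < E.natDegree := by omega
  have := isGalois (Ω := Ω) (F := F) hE hE0 hE'
  have := IsSplittingField.finiteDimensional Ω (shifted F E)
  let _ : Fintype Gal(Ω/F) := Fintype.ofFinite _
  have hcard := natDegree_eq_card (F := F) (Ω := Ω) hE hE0 hE' hs.splits
  have hne := nonempty_rootSet hE hE0 hs.splits
  have hf := faithfulSMul (F := F) (Ω := Ω) E
  have h := isRootCover (F := F) (Ω := Ω) hE hE0 hE'
  obtain ⟨τ, hτ, hτσ, hτX, hτy⟩ := exists_semilinear_rootAlgebra (F := F) (Ω := Ω) hE hE0 hσ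
  obtain ⟨g, hg⟩ := h.exists_smul_eq_of_semilinear (fun g i => root_smul g i) hEc hE3 hE2
    (hcard.trans hdeg) hd hodd (by rw [hcard, hdeg]; exact hw) hτ hτσ hσw hτy
  obtain ⟨κ, hκ⟩ := h.card_dvd_card fun g i => root_smul g i
  have hfact := card_le_factorial (F := F) (Ω := Ω) hE hE0 hE'
  obtain ⟨χ, hχ, hχT, hχy⟩ := h.exists_rational_point hE' hκ
    (fun M => le_finrank_degOneSpan hE hE0 hE' (by rw [hκ, hcard]) M)
    (τ := (MulSemiringAction.toRingHom Gal(Ω/F) (rootAlgebra F Ω E) g).comp τ) (σ := σ)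
    ((MulAction.injective g).comp hτ)
    (fun c => by
      rw [RingHom.comp_apply, hτσ]
      exact smul_algebraMap g _) hσq hg
    (by
      rw [RingHom.comp_apply, hτX]
      exact h.smul_T g) R hR hRn (le_trans (by gcongr; rwa [hdeg] at hfact) hn)
  refine ⟨_, hχT, Finset.univ.image fun i => χ (rootAlgebra.root E i), ?_, ?_⟩
  · rw [Finset.card_image_of_injective _ hχ, Finset.card_univ, hcard, hdeg]
  · intro r hr
    obtain ⟨i, -, rfl⟩ := Finset.mem_image.1 hr
    refine ⟨?_, hχy i⟩
    rw [← coe_aeval_eq_eval, aeval_algHom_apply, h.aeval_y]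

end RootCover

open RootCover in
/-- A polynomial with simple ramification over the algebraic closure of a finite field, defined
over that field and invariant under `X ↦ X + 1`, has a totally split value there. -/
theorem exists_totally_split {K : Type*} [Field K] [IsAlgClosed K] [CharP K 2]
    {E : K[X]} {d : ℕ}
    (hE : E.Monic) (hdeg : E.natDegree = 2 * d) (hd : 2 ≤ d) (hodd : Odd d)
    (hE' : derivative E ≠ 0) (hEc : E.comp (X + 1) = E)
    (hE3 : ∀ r, (derivative E).IsRoot r → ¬ (X - C r) ^ 3 ∣ E - C (eval r E))
    (hE2 : ∀ r r', (derivative E).IsRoot r → (derivative E).IsRoot r' → eval r E = eval r' E →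
      r' = r ∨ r' = r + 1)
    {w : K} (hw : w ^ 2 + w = E.coeff (2 * d - 2) + d.choose 2) {σ : K →+* K} (hσ : E.map σ = E)
    (hσw : σ w = w) {n : ℕ} (hσq : ∀ c, σ c ^ 2 ^ n = c) (R : Finset K) (hR : R.card = 2 ^ n)
    (hRn : ∀ t ∈ R, t ^ 2 ^ n = t) (hn : 10 * ((2 * d).factorial + 2) ^ 4 ≤ 2 ^ (n / 2)) :
    ∃ t : K, t ^ 2 ^ n = t ∧ ∃ s : Finset K, s.card = 2 * d ∧
      ∀ r ∈ s, eval r E = t ∧ r ^ 2 ^ n = r := by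
  let F := FractionRing K[X]
  let Ω := (shifted F E).SplittingField
  let _ : Algebra K Ω := ((algebraMap K[X] Ω).comp C).toAlgebra
  have : @IsScalarTower K K[X] Ω _ Algebra.toSMul Algebra.toSMul :=
    IsScalarTower.of_algebraMap_eq' rfl
  exact RootCover.exists_totally_split (F := F) (Ω := Ω) hE hdeg hd hodd hE' hEc hE3 hE2 hw hσ hσw
    hσq R hR hRn hn

/-- The normalized derivative in direction `1` of `a X ^ (e + 2) + X ^ (e + 1) + b X ^ e` in
characteristic two. -/
noncomputable def diffPoly {K : Type*} [Field K] (a b : K) (e : ℕ) : K[X] :=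
  C a * ((X + 1) ^ (e + 2) + X ^ (e + 2)) + ((X + 1) ^ (e + 1) + X ^ (e + 1)) +
    C b * ((X + 1) ^ e + X ^ e)

namespace diffPoly

variable {K : Type*} [Field K]

theorem eval_eq (a b r : K) (e : ℕ) : eval r (diffPoly a b e) =
    a * ((r + 1) ^ (e + 2) + r ^ (e + 2)) + ((r + 1) ^ (e + 1) + r ^ (e + 1)) +
      b * ((r + 1) ^ e + r ^ e) := by
  simp [diffPoly]

theorem coeff_eq (a b : K) (e k : ℕ) : (diffPoly a b e).coeff k =
    a * ((e + 2).choose k + if k = e + 2 then 1 else 0) +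
      ((e + 1).choose k + if k = e + 1 then 1 else 0) + b * (e.choose k + if k = e then 1 else 0) := by
  simp only [diffPoly, coeff_add, coeff_C_mul, coeff_X_add_one_pow, coeff_X_pow]

theorem map_eq {σ : K →+* K} {a b : K} (ha : σ a = a) (hb : σ b = b) (e : ℕ) :
    (diffPoly a b e).map σ = diffPoly a b e := by
  simp [diffPoly, ha, hb]

variable [CharP K 2]

theorem cast_choose_eq (n k : ℕ) :
    (n.choose k : K) = (n % 2).choose (k % 2) * (n / 2).choose (k / 2) := by
  rw [← Nat.cast_mul, CharP.natCast_eq_natCast K 2]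
  exact Choose.choose_modEq_choose_mod_mul_choose_div_nat

theorem cast_of_mod_two_eq_zero {n : ℕ} (h : n % 2 = 0) : (n : K) = 0 :=
  (CharP.cast_eq_zero_iff K 2 n).2 (Nat.dvd_of_mod_eq_zero h)

theorem cast_of_mod_two_eq_one {n : ℕ} (h : n % 2 = 1) : (n : K) = 1 := by
  rw [← Nat.cast_one, CharP.natCast_eq_natCast K 2]
  exact h

theorem cast_choose_two_of_mod_four {n : ℕ} (h : n % 4 = 2 ∨ n % 4 = 3) :
    (n.choose 2 : K) = 1 := by
  rw [cast_choose_eq, Nat.mod_self, Nat.choose_zero_right, Nat.cast_one, one_mul,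
    Nat.div_self two_pos, Nat.choose_one_right, cast_of_mod_two_eq_one (by omega : n / 2 % 2 = 1)]

theorem cast_choose_two_of_mod_four_eq_zero {n : ℕ} (h : n % 4 = 0) :
    (n.choose 2 : K) = 0 := by
  rw [cast_choose_eq, Nat.mod_self, Nat.choose_zero_right, Nat.cast_one, one_mul,
    Nat.div_self two_pos, Nat.choose_one_right, cast_of_mod_two_eq_zero (by omega : n / 2 % 2 = 0)]

theorem comp_X_add_one (a b : K) (e : ℕ) : (diffPoly a b e).comp (X + 1) = diffPoly a b e := by
  have h : (X + 1 + 1 : K[X]) = X := by rw [add_assoc, CharTwo.add_self_eq_zero, add_zero]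
  simp only [diffPoly, add_comp, mul_comp, C_comp, pow_comp, X_comp, one_comp, h]
  ring

theorem natDegree_le {a b : K} {e : ℕ} (he : e % 4 = 2) : (diffPoly a b e).natDegree ≤ e := by
  rw [natDegree_le_iff_coeff_eq_zero]
  intro k hk
  rw [coeff_eq, Nat.choose_eq_zero_of_lt hk, if_neg hk.ne']
  rcases Nat.lt_or_ge (e + 2) k with h | h
  · rw [Nat.choose_eq_zero_of_lt h, Nat.choose_eq_zero_of_lt (by omega), if_neg (by omega),
      if_neg (by omega)]
    simp
  · obtain rfl | rfl : k = e + 1 ∨ k = e + 2 := by omega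
    · have h2 : ((e + 2 : ℕ) : K) = 0 := cast_of_mod_two_eq_zero (by omega)
      rw [Nat.choose_symm_of_eq_add (show e + 2 = e + 1 + 1 from rfl), Nat.choose_one_right, h2]
      simp [CharTwo.add_self_eq_zero]
    · simp [CharTwo.add_self_eq_zero]

theorem coeff_self {a b : K} {e : ℕ} (he : e % 4 = 2) : (diffPoly a b e).coeff e = 1 := by
  rw [coeff_eq, Nat.choose_symm_add, cast_choose_two_of_mod_four_eq_zero (by omega),
    Nat.choose_symm_add, Nat.choose_one_right, cast_of_mod_two_eq_one (by omega)]
  simp [CharTwo.add_self_eq_zero]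

theorem monic {a b : K} {e : ℕ} (he : e % 4 = 2) : (diffPoly a b e).Monic :=
  monic_of_natDegree_le_of_coeff_eq_one e (natDegree_le he) (coeff_self he)

theorem natDegree_eq {a b : K} {e : ℕ} (he : e % 4 = 2) : (diffPoly a b e).natDegree = e :=
  le_antisymm (natDegree_le he) (le_natDegree_of_ne_zero (by rw [coeff_self he]; exact one_ne_zero))

theorem derivative_eq {a b : K} {e : ℕ} (he : e % 4 = 2) :
    derivative (diffPoly a b e) = (X + 1) ^ e + X ^ e := by
  have h0 : (e : K[X]) = 0 := by
    rw [← C_eq_natCast, cast_of_mod_two_eq_zero (by omega), C_0]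
  simp [diffPoly, derivative_pow, h0, CharTwo.two_eq_zero]

theorem derivative_ne_zero {a b : K} {e : ℕ} (he : e % 4 = 2) :
    derivative (diffPoly a b e) ≠ 0 := by
  rw [derivative_eq he]
  intro h
  have h1 := congrArg (eval 0) h
  simp [show e ≠ 0 by omega] at h1

theorem isRoot_derivative {a b r : K} {e : ℕ} (he : e % 4 = 2) :
    (derivative (diffPoly a b e)).IsRoot r ↔ (r + 1) ^ e = r ^ e := by
  rw [derivative_eq he, IsRoot.def, eval_add, eval_pow, eval_pow, eval_add, eval_X, eval_one,
    CharTwo.add_eq_zero]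

theorem ne_zero_of_isRoot {r : K} {e : ℕ} (he : e % 4 = 2) (h : (r + 1) ^ e = r ^ e) :
    r ≠ 0 ∧ r + 1 ≠ 0 := by
  have he0 : e ≠ 0 := by omega
  constructor
  · rintro rfl
    simp [he0] at h
  · intro h1
    rw [h1, zero_pow he0, CharTwo.add_eq_zero.1 h1, one_pow] at h
    exact zero_ne_one h

theorem eval_of_isRoot {a b r : K} {e : ℕ} (h : (r + 1) ^ e = r ^ e) :
    eval r (diffPoly a b e) = (a + 1) * r ^ e := by
  rw [eval_eq, pow_add, pow_add, pow_succ (r + 1) e, h]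
  linear_combination (a * r ^ e * r * (r + 1) + r ^ e * r + b * r ^ e) * CharTwo.two_eq_zero (R := K)

theorem not_cube_dvd {a b r : K} {e : ℕ} (he : e % 4 = 2) (h : (r + 1) ^ e = r ^ e)
    (hb : b ≠ r * (r + 1)) :
    ¬ (X - C r) ^ 3 ∣ diffPoly a b e - C (eval r (diffPoly a b e)) := by
  intro hdvd
  obtain ⟨k, rfl⟩ : ∃ k, e = k + 2 := ⟨e - 2, by omega⟩
  obtain ⟨h0, h1⟩ := ne_zero_of_isRoot he h
  obtain ⟨Q, hQ⟩ := hdvd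
  have h2 : (taylor r (diffPoly a b (k + 2))).coeff 2 = 0 := by
    rw [← sub_add_cancel (diffPoly a b (k + 2)) (C (eval r (diffPoly a b (k + 2)))), hQ, map_add,
      taylor_mul, taylor_pow, map_sub, taylor_X, taylor_C, add_sub_cancel_right, coeff_add,
      coeff_X_pow_mul', taylor_C, coeff_C]
    simp
  have h3 : taylor r (diffPoly a b (k + 2)) =
      C a * ((X + C (r + 1)) ^ (k + 2 + 2) + (X + C r) ^ (k + 2 + 2)) +
      ((X + C (r + 1)) ^ (k + 2 + 1) + (X + C r) ^ (k + 2 + 1)) +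
      C b * ((X + C (r + 1)) ^ (k + 2) + (X + C r) ^ (k + 2)) := by
    simp only [diffPoly, taylor_apply, add_comp, mul_comp, C_comp, pow_comp, X_comp, one_comp, C_add,
      C_1, add_assoc]
  simp only [h3, coeff_add, coeff_C_mul, coeff_X_add_C_pow] at h2
  rw [cast_choose_two_of_mod_four_eq_zero (by omega), cast_choose_two_of_mod_four (by omega),
    cast_choose_two_of_mod_four (by omega), Nat.add_sub_cancel, Nat.add_sub_cancel, show k + 2 + 1 - 2 = k + 1 by omega] at h2
  have h4 : r ^ (k + 2) * (r * (r + 1) + b) = 0 := by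
    linear_combination (r * (r + 1)) ^ 2 * h2 - (r ^ 2 * (r + 1) + b * r ^ 2) * h -
      (r ^ (k + 2) * (r * (r + 1) * r + b * r * (r + 1))) * CharTwo.two_eq_zero (R := K)
  rcases mul_eq_zero.1 h4 with h5 | h5
  · exact pow_ne_zero _ h0 h5
  · exact hb (CharTwo.add_eq_zero.1 h5).symm

theorem eq_or_eq_add_one {a b r r' : K} {e : ℕ} (he : e % 4 = 2) (ha : a ≠ 1)
    (hM : ∀ ζ₁ ζ₂ : K, ζ₁ ≠ 1 → ζ₂ ≠ 1 → ζ₁ ^ e = 1 → ζ₂ ^ e = 1 →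
      ((1 + ζ₁) / (1 + ζ₂)) ^ e = 1 → ζ₁ = ζ₂ ∨ ζ₁ = ζ₂⁻¹)
    (h : (r + 1) ^ e = r ^ e) (h' : (r' + 1) ^ e = r' ^ e)
    (heq : eval r (diffPoly a b e) = eval r' (diffPoly a b e)) : r' = r ∨ r' = r + 1 := by
  rw [eval_of_isRoot h, eval_of_isRoot h'] at heq
  have hpow : r ^ e = r' ^ e := mul_left_cancel₀ (fun h0 => ha (CharTwo.add_eq_zero.1 h0)) heq
  obtain ⟨h1, h2⟩ := ne_zero_of_isRoot he h
  obtain ⟨h1', h2'⟩ := ne_zero_of_isRoot he h'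
  have hinv : ∀ s : K, s ≠ 0 → 1 + (s + 1) / s = s⁻¹ := fun s hs => by
    field_simp
    linear_combination s * CharTwo.two_eq_zero (R := K)
  have key := hM ((r + 1) / r) ((r' + 1) / r') (by rw [Ne, div_eq_one_iff_eq h1]; simp)
    (by rw [Ne, div_eq_one_iff_eq h1']; simp)
    (by rw [div_pow, h, div_self (pow_ne_zero _ h1)])
    (by rw [div_pow, h', div_self (pow_ne_zero _ h1')])
    (by rw [hinv r h1, hinv r' h1', div_pow, inv_pow, inv_pow, hpow,
      div_self (inv_ne_zero (pow_ne_zero _ h1'))])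
  rcases key with key | key
  · left
    rw [div_eq_div_iff h1 h1'] at key
    linear_combination key
  · right
    rw [inv_div, div_eq_div_iff h1 h2'] at key
    linear_combination key - (r + 1) * CharTwo.two_eq_zero (R := K)

theorem coeff_sub_two {a b : K} (j : ℕ) :
    (diffPoly a b (2 * (2 * j + 1))).coeff (2 * (2 * j + 1) - 2) + ((2 * j + 1).choose 2 : K) =
      (j + 1) * (a + 1) + b := by
  rw [show 2 * (2 * j + 1) = 4 * j + 2 by ring, Nat.add_sub_cancel, coeff_eq,
    if_neg (by omega), if_neg (by omega), if_neg (by omega), add_assoc (4 * j), Nat.choose_symm_add,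
    add_assoc (4 * j), Nat.choose_symm_add, Nat.choose_symm_add,
    cast_choose_two_of_mod_four (by omega), cast_choose_eq (4 * j + _) (2 + 2),
    cast_choose_eq (4 * j + _) (2 + 1), cast_choose_eq (2 * j + 1) 2,
    show (4 * j + (2 + 2)) % 2 = 0 by omega, show (4 * j + (2 + 2)) / 2 = 2 * j + 2 by omega,
    show (4 * j + (2 + 1)) % 2 = 1 by omega, show (4 * j + (2 + 1)) / 2 = 2 * j + 1 by omega,
    show (2 * j + 1) % 2 = 1 by omega, show (2 * j + 1) / 2 = j by omega,
    cast_choose_eq (2 * j + 2), show (2 * j + 2) % 2 = 0 by omega,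
    show (2 * j + 2) / 2 = j + 1 by omega]
  norm_num
  linear_combination (j : K) * CharTwo.two_eq_zero (R := K)

end diffPoly

theorem RingHom.exists_map_eq_of_pow_card_eq {k K : Type*} [Field k] [Fintype k] [Field K]
    (f : k →+* K) {x : K} (hx : x ^ Fintype.card k = x) : ∃ a, f a = x := by
  classical
  have hq := Fintype.one_lt_card (α := k)
  have h0 := FiniteField.X_pow_card_sub_X_ne_zero K hq
  have h1 : Finset.univ.image f ⊆ (X ^ Fintype.card k - X : K[X]).roots.toFinset := by
    intro y hy
    obtain ⟨a, -, rfl⟩ := Finset.mem_image.1 hy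
    simp [mem_roots h0, ← map_pow, FiniteField.pow_card]
  have h2 : (X ^ Fintype.card k - X : K[X]).roots.toFinset.card ≤ (Finset.univ.image f).card := by
    rw [Finset.card_image_of_injective _ f.injective, Finset.card_univ]
    calc _ ≤ (X ^ Fintype.card k - X : K[X]).roots.card := Multiset.toFinset_card_le _
      _ ≤ _ := card_roots' _
      _ = _ := FiniteField.X_pow_card_sub_X_natDegree_eq K hq
  have h3 : x ∈ Finset.univ.image f := by
    rw [Finset.eq_of_subset_of_card_le h1 h2]
    simp [mem_roots h0, hx]
  obtain ⟨a, -, ha⟩ := Finset.mem_image.1 h3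
  exact ⟨a, ha⟩

theorem diffPoly.exists_totally_split {k K : Type*} [Field k] [Fintype k] [Field K] [IsAlgClosed K]
    [CharP K 2] (f : k →+* K) {n : ℕ} (hcard : Fintype.card k = 2 ^ n) {j : ℕ} (hj : 1 ≤ j)
    {a b w : k} (ha : a ≠ 1)
    (hb : ∀ r : K, (r + 1) ^ (4 * j + 2) = r ^ (4 * j + 2) → f b ≠ r * (r + 1))
    (hM : ∀ ζ₁ ζ₂ : K, ζ₁ ≠ 1 → ζ₂ ≠ 1 → ζ₁ ^ (4 * j + 2) = 1 → ζ₂ ^ (4 * j + 2) = 1 →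
      ((1 + ζ₁) / (1 + ζ₂)) ^ (4 * j + 2) = 1 → ζ₁ = ζ₂ ∨ ζ₁ = ζ₂⁻¹)
    (hw : w ^ 2 + w = (j + 1) * (a + 1) + b)
    (hn : 10 * ((4 * j + 2).factorial + 2) ^ 4 ≤ 2 ^ (n / 2)) :
    ∃ t : k, ∃ s : Finset k, s.card = 4 * j + 2 ∧
      ∀ r ∈ s, eval r (diffPoly a b (4 * j + 2)) = t := by
  classical
  have he : (4 * j + 2) % 4 = 2 := by omega
  have he' : 4 * j + 2 = 2 * (2 * j + 1) := by ring
  have hf : ∀ x, f x ^ 2 ^ n = f x := fun x => by rw [← map_pow, ← hcard, FiniteField.pow_card]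
  have hσf : ∀ x, (iterateFrobeniusEquiv K 2 n).symm (f x) = f x := fun x => by
    rw [RingEquiv.symm_apply_eq, iterateFrobeniusEquiv_def, hf]
  have hroot := fun r : K => diffPoly.isRoot_derivative (a := f a) (b := f b) (r := r) he
  obtain ⟨t, ht, s, hs, hst⟩ := _root_.exists_totally_split (K := K) (E := diffPoly (f a) (f b) (4 * j + 2))
    (d := 2 * j + 1) (w := f w) (n := n) (σ := ((iterateFrobeniusEquiv K 2 n).symm : K →+* K))
    (diffPoly.monic he) ((diffPoly.natDegree_eq he).trans he') (by omega) ⟨j, rfl⟩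
    (diffPoly.derivative_ne_zero he) (diffPoly.comp_X_add_one _ _ _)
    (fun r hr => diffPoly.not_cube_dvd he ((hroot r).1 hr) (hb r ((hroot r).1 hr)))
    (fun r r' hr hr' => diffPoly.eq_or_eq_add_one he
      (fun h => ha (f.injective (h.trans (map_one f).symm))) hM ((hroot r).1 hr) ((hroot r').1 hr'))
    (by
      rw [he', diffPoly.coeff_sub_two, ← map_pow, ← map_add, hw]
      simp)
    (diffPoly.map_eq (hσf a) (hσf b) _) (hσf w)
    (fun c => (iterateFrobeniusEquiv K 2 n).apply_symm_apply c)
    (Finset.univ.image f) (by rw [Finset.card_image_of_injective _ f.injective, Finset.card_univ, hcard])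
    (fun t ht => by
      obtain ⟨x, -, rfl⟩ := Finset.mem_image.1 ht
      exact hf x)
    (by rwa [← he'])
  rw [← hcard] at ht
  obtain ⟨t, rfl⟩ := f.exists_map_eq_of_pow_card_eq ht
  refine ⟨t, s.preimage f f.injective.injOn, ?_, fun r hr => ?_⟩
  · rw [he', ← hs, ← Finset.card_image_of_injective _ f.injective, Finset.image_preimage,
      Finset.filter_true_of_mem]
    intro r hr
    exact f.exists_map_eq_of_pow_card_eq (by rw [hcard, (hst r hr).2])
  · apply f.injective
    rw [← (hst (f r) (Finset.mem_preimage.1 hr)).1, diffPoly.eval_eq, diffPoly.eval_eq]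
    simp

section ArtinSchreier

variable (k : Type*) [Field k] [CharP k 2]

/-- The additive map `x ↦ x ^ 2 + x` of a field of characteristic two. -/
def artinSchreier : k →+ k where
  toFun x := x ^ 2 + x
  map_zero' := by simp
  map_add' x y := by
    linear_combination (x * y) * CharTwo.two_eq_zero (R := k)

theorem index_range_artinSchreier [Finite k] : (artinSchreier k).range.index = 2 := by
  rw [AddSubgroup.index_range]
  have h : ((artinSchreier k).ker : Set k) = {0, 1} := by
    ext x
    have h1 : x ^ 2 + x = x * (x + 1) := by ring
    change x ^ 2 + x = 0 ↔ _
    rw [h1, mul_eq_zero, CharTwo.add_eq_zero]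
    rfl
  change Nat.card ((artinSchreier k).ker : Set k) = 2
  rw [h, Nat.card_coe_set_eq, Set.ncard_pair zero_ne_one]

variable {k}

theorem exists_mem_range_artinSchreier_notMem [Fintype k] (T : Finset k)
    (hT : 2 * T.card < Fintype.card k) : ∃ w : k, w ^ 2 + w ∉ T := by
  classical
  by_contra! h
  have h1 := (artinSchreier k).range.card_mul_index
  rw [index_range_artinSchreier, Nat.card_eq_fintype_card (α := k)] at h1
  have h2 : Nat.card ((artinSchreier k).range : Set k) ≤ Nat.card (T : Set k) :=
    Nat.card_mono T.finite_toSet (by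
      rintro _ ⟨w, rfl⟩
      exact h w)
  rw [Nat.card_coe_set_eq (T : Set k), Set.ncard_coe_finset] at h2
  change Nat.card (artinSchreier k).range ≤ _ at h2
  omega

/-- Away from a bounded set of `a`, the equation `w ^ 2 + w = i (a + 1) + c / a` is solvable. -/
theorem exists_artinSchreier_eq [Fintype k] (S : Finset k) (h0 : 0 ∈ S)
    (hS : 6 * S.card + 10 < Fintype.card k) (i : ℕ) (c : k) :
    ∃ a ∉ S, ∃ w : k, w ^ 2 + w = i * (a + 1) + c / a := by
  classical
  rcases Nat.even_or_odd i with hi | hi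
  · have hi0 : (i : k) = 0 := (CharP.cast_eq_zero_iff k 2 i).2 hi.two_dvd
    rcases eq_or_ne c 0 with rfl | hc
    · obtain ⟨a, -, ha⟩ := Finset.exists_mem_notMem_of_card_lt_card (s := S) (t := Finset.univ)
        (by rw [Finset.card_univ]; omega)
      exact ⟨a, ha, 0, by simp [hi0]⟩
    · obtain ⟨w, hw⟩ := exists_mem_range_artinSchreier_notMem (S.image fun s => c / s) (by
        have := Finset.card_image_le (s := S) (f := fun s => c / s)
        omega)
      have hw0 : w ^ 2 + w ≠ 0 := fun h => hw (Finset.mem_image.2 ⟨0, h0, by rw [h, div_zero]⟩)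
      refine ⟨c / (w ^ 2 + w), fun h => hw (Finset.mem_image.2 ⟨_, h, ?_⟩), w, ?_⟩
      · exact div_div_cancel₀ hc
      · rw [hi0, zero_mul, zero_add, div_div_cancel₀ hc]
  · have hi1 : (i : k) = 1 := by
      rw [← Nat.cast_one, CharP.natCast_eq_natCast k 2]
      exact Nat.odd_iff.1 hi
    rcases eq_or_ne c 0 with rfl | hc
    · obtain ⟨w, hw⟩ := exists_mem_range_artinSchreier_notMem (S.image fun s => s + 1) (by
        have := Finset.card_image_le (s := S) (f := fun s => s + 1)
        omega)
      have h1 : w ^ 2 + w + 1 + 1 = w ^ 2 + w := by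
        rw [add_assoc, CharTwo.add_self_eq_zero, add_zero]
      exact ⟨w ^ 2 + w + 1, fun h => hw (Finset.mem_image.2 ⟨_, h, h1⟩), w, by simp [hi1, h1]⟩
    · by_contra! hcon
      obtain ⟨z, -, hz⟩ := Finset.exists_mem_notMem_of_card_lt_card
        (s := (X ^ 4 - X : k[X]).roots.toFinset) (t := Finset.univ) (by
          have h1 := Multiset.toFinset_card_le (X ^ 4 - X : k[X]).roots
          have h2 := card_roots' (X ^ 4 - X : k[X])
          rw [FiniteField.X_pow_card_sub_X_natDegree_eq k (by norm_num)] at h2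
          rw [Finset.card_univ]
          omega)
      have hz4 : z ^ 4 - z ≠ 0 := fun h => hz (by
        rw [Multiset.mem_toFinset, mem_roots (FiniteField.X_pow_card_sub_X_ne_zero k (by norm_num))]
        simpa using h)
      have hz0 : z ≠ 0 := fun h => hz4 (by simp [h])
      have hz1 : 1 + z ≠ 0 := fun h => hz4 (by
        rw [← CharTwo.add_eq_zero.1 h]
        simp)
      set u := 1 + 1 / z + 1 / (1 + z) with hu
      have hu0 : u ≠ 0 := fun h => hz4 (by
        rw [hu] at h
        field_simp at h
        linear_combination (z ^ 2 - z) * h - (z ^ 3 - z ^ 2) * CharTwo.two_eq_zero (R := k))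
      let H := (artinSchreier k).range
      have hH : H.index = 2 := index_range_artinSchreier k
      have hnot : ∀ a ∉ S, a + 1 + c / a ∉ H := by
        rintro a ha ⟨w, hw⟩
        exact hcon a ha w (by rw [hi1, one_mul]; exact hw)
      obtain ⟨w, hw⟩ := exists_mem_range_artinSchreier_notMem (insert 1
        (S.image (fun s => 1 + c * u / s) ∪ (S.image (fun s => 1 + c * u * z / s) ∪
          S.image fun s => 1 + c * u * (1 + z) / s))) (by
        have h1 := Finset.card_insert_le 1 (S.image (fun s => 1 + c * u / s) ∪
          (S.image (fun s => 1 + c * u * z / s) ∪ S.image fun s => 1 + c * u * (1 + z) / s))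
        have h2 := Finset.card_union_le (S.image (fun s => 1 + c * u / s))
          (S.image (fun s => 1 + c * u * z / s) ∪ S.image fun s => 1 + c * u * (1 + z) / s)
        have h3 := Finset.card_union_le (S.image fun s => 1 + c * u * z / s)
          (S.image fun s => 1 + c * u * (1 + z) / s)
        have h4 := Finset.card_image_le (s := S) (f := fun s => 1 + c * u / s)
        have h5 := Finset.card_image_le (s := S) (f := fun s => 1 + c * u * z / s)
        have h6 := Finset.card_image_le (s := S) (f := fun s => 1 + c * u * (1 + z) / s)
        omega)
      simp only [Finset.mem_insert, Finset.mem_union, Finset.mem_image, not_or, not_exists,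
        not_and] at hw
      obtain ⟨hw1, hw2, hw3, hw4⟩ := hw
      have hv : w ^ 2 + w - 1 ≠ 0 := sub_ne_zero.2 hw1
      have hcu : c * u ≠ 0 := mul_ne_zero hc hu0
      set a := c * u / (w ^ 2 + w - 1) with ha
      have ha0 : a ≠ 0 := div_ne_zero hcu hv
      have hav : 1 + c * u / a = w ^ 2 + w := by rw [ha, div_div_cancel₀ hcu]; ring
      have h1 := hnot a fun h => hw2 a h hav
      have h2 := hnot (a * z) fun h => hw3 _ h (by rw [mul_div_mul_right _ _ hz0, hav])
      have h3 := hnot (a * (1 + z)) fun h => hw4 _ h (by rw [mul_div_mul_right _ _ hz1, hav])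
      have h4 : (a + 1 + c / a) + (a * z + 1 + c / (a * z)) ∈ H :=
        (AddSubgroup.add_mem_iff_of_index_two hH).2 (iff_of_false h1 h2)
      have h5 : w ^ 2 + w ∈ H := ⟨w, rfl⟩
      refine h3 ?_
      have h6 : a * (1 + z) + 1 + c / (a * (1 + z)) =
          (w ^ 2 + w) - ((a + 1 + c / a) + (a * z + 1 + c / (a * z))) := by
        have h7 : c * u / a = c / a + c / (a * z) + c / (a * (1 + z)) := by
          rw [hu]
          clear_value a
          field_simp
        linear_combination (a * (1 + z) + 1) * CharTwo.two_eq_zero (R := k) + hav - h7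
      rw [h6]
      exact sub_mem h5 h4

end ArtinSchreier

theorem Finset.card_le_card_subtype {α : Type*} [Finite α] (s : Finset α) {P : α → Prop}
    (h : ∀ x ∈ s, P x) : s.card ≤ Nat.card {x // P x} := by
  rw [← Set.ncard_coe_finset, ← Nat.card_coe_set_eq]
  exact Nat.card_mono (t := {x | P x}) (Set.toFinite _) h

theorem card_eq_card_diffPoly {k : Type*} [Field k] [CharP k 2] {a₀ a₁ a₂ α : k} (ha₁ : a₁ ≠ 0)
    (hα : α ≠ 0) (β : k) (e : ℕ) :
    Nat.card {x : k // (C a₀ * X ^ (e + 2) + C a₁ * X ^ (e + 1) + C a₂ * X ^ e).eval (x + α) -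
      (C a₀ * X ^ (e + 2) + C a₁ * X ^ (e + 1) + C a₂ * X ^ e).eval x = β} =
    Nat.card {y : k // (diffPoly (a₀ * α / a₁) (a₂ / (a₁ * α)) e).eval y =
      β / (a₁ * α ^ (e + 1))} := by
  have h0 : a₁ * α ^ (e + 1) ≠ 0 := mul_ne_zero ha₁ (pow_ne_zero _ hα)
  refine (Nat.card_congr ((Equiv.mulLeft₀ α hα).subtypeEquiv fun y => ?_)).symm
  rw [eq_div_iff h0, diffPoly.eval_eq, Equiv.mulLeft₀_apply, show α * y + α = α * (y + 1) by ring,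
    CharTwo.sub_eq_add]
  simp only [eval_add, eval_mul, eval_C, eval_pow, eval_X, mul_pow]
  refine Eq.congr_left ?_
  field_simp
  ring

theorem card_eval_eq_le {k : Type*} [Field k] {p : k[X]} (hp : 0 < p.natDegree) (t : k) :
    Nat.card {y : k // p.eval y = t} ≤ p.natDegree := by
  classical
  have h0 : p - C t ≠ 0 := fun h => by
    have h1 := natDegree_sub_C (p := p) (a := t)
    rw [h, natDegree_zero] at h1
    omega
  have h1 : {y : k | p.eval y = t} = ((p - C t).roots.toFinset : Set k) := by
    ext y
    simp [mem_roots h0, sub_eq_zero]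
  change Nat.card {y : k | p.eval y = t} ≤ _
  rw [h1, Nat.card_coe_set_eq, Set.ncard_coe_finset, ← natDegree_sub_C (a := t)]
  exact (Multiset.toFinset_card_le _).trans (card_roots' _)

/-- For all but boundedly many `a`, no critical point `r` satisfies `r (r + 1) = c / a`. -/
theorem exists_exceptional_finset {k K : Type*} [Field k] [Field K] [CharP K 2] (f : k →+* K)
    (c : k) {e : ℕ} (he : e % 4 = 2) : ∃ S : Finset k, 0 ∈ S ∧ 1 ∈ S ∧ S.card ≤ e + 2 ∧
      ∀ a ∉ S, ∀ r : K, (r + 1) ^ e = r ^ e → f (c / a) ≠ r * (r + 1) := by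
  classical
  set p := derivative (diffPoly (0 : K) 0 e) with hp
  set R := p.roots.toFinset.image fun r => f c / (r * (r + 1)) with hR
  have hRc : R.card ≤ e := by
    refine Finset.card_image_le.trans ((Multiset.toFinset_card_le _).trans ((card_roots' _).trans ?_))
    exact (natDegree_derivative_le _).trans
      ((Nat.sub_le _ _).trans (diffPoly.natDegree_eq he).le)
  have hpre : (R.preimage f f.injective.injOn).card ≤ R.card :=
    Finset.card_le_card_of_injOn f (fun x hx => by simpa using hx) f.injective.injOn
  refine ⟨insert 0 (insert 1 (R.preimage f f.injective.injOn)), by simp, by simp, ?_, ?_⟩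
  · have h1 := Finset.card_insert_le 0 (insert 1 (R.preimage f f.injective.injOn))
    have h2 := Finset.card_insert_le 1 (R.preimage f f.injective.injOn)
    omega
  · intro a ha r hr h
    simp only [Finset.mem_insert, Finset.mem_preimage, not_or] at ha
    obtain ⟨h0, h1⟩ := diffPoly.ne_zero_of_isRoot he hr
    have hfa : f a ≠ 0 := (map_ne_zero f).2 ha.1
    refine ha.2.2 (Finset.mem_image.2 ⟨r, ?_, ?_⟩)
    · rw [Multiset.mem_toFinset, mem_roots (diffPoly.derivative_ne_zero he)]
      exact (diffPoly.isRoot_derivative he).2 hr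
    · rw [map_div₀, div_eq_iff hfa] at h
      rw [h, mul_div_cancel_left₀ _ (mul_ne_zero h0 h1)]

/-- Let `m ≥ 8` with `m ≡ 0 (mod 4)` and `m - 1 ∈ 𝓜`.  Then for `n` sufficiently large
(depending only on `m`), every trinomial `a₀ x^m + a₁ x^(m-1) + a₂ x^(m-2)` over `𝔽_{2^n}`
of degree `m` (i.e. `a₀ ≠ 0`) with `a₁ ≠ 0` has maximal differential uniformity `m - 2`. -/
theorem trinomial_diffUnif_eq_sub_two (m : ℕ) (hm : 8 ≤ m) (hm4 : m % 4 = 0)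
    (hM : InM (m - 1)) :
    ∃ N : ℕ, ∀ n : ℕ, N ≤ n → ∀ a₀ a₁ a₂ : GaloisField 2 n, a₀ ≠ 0 → a₁ ≠ 0 →
      diffUnif (C a₀ * X ^ m + C a₁ * X ^ (m - 1) + C a₂ * X ^ (m - 2)) = m - 2 := by
  obtain ⟨j, hj, rfl⟩ : ∃ j, 1 ≤ j ∧ m = 4 * j + 2 + 2 := ⟨m / 4 - 1, by omega, by omega⟩
  refine ⟨2 * (10 * ((4 * j + 2).factorial + 2) ^ 4), fun n hN a₀ a₁ a₂ ha₀ ha₁ => ?_⟩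
  have he : (4 * j + 2) % 4 = 2 := by omega
  have hn : 10 * ((4 * j + 2).factorial + 2) ^ 4 ≤ 2 ^ (n / 2) :=
    Nat.lt_two_pow_self.le.trans (Nat.pow_le_pow_right two_pos (by omega))
  have hfact : 4 * j + 4 ≤ ((4 * j + 2).factorial + 2) ^ 4 :=
    (Nat.add_le_add_right (Nat.self_le_factorial (4 * j + 2)) 2).trans
      (Nat.le_self_pow (by norm_num) _)
  let _ : Fintype (GaloisField 2 n) := Fintype.ofFinite _
  have hcard : Fintype.card (GaloisField 2 n) = 2 ^ n := by
    rw [← Nat.card_eq_fintype_card]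
    exact GaloisField.card 2 n (by omega)
  let f : GaloisField 2 n →+* AlgebraicClosure (ZMod 2) :=
    (IsAlgClosed.lift : GaloisField 2 n →ₐ[ZMod 2] AlgebraicClosure (ZMod 2))
  rw [show 4 * j + 2 + 2 - 1 = 4 * j + 2 + 1 by omega, Nat.add_sub_cancel, diffUnif]
  have hle : ∀ a b t : GaloisField 2 n,
      Nat.card {y // (diffPoly a b (4 * j + 2)).eval y = t} ≤ 4 * j + 2 := fun a b t => by
    have h1 := diffPoly.natDegree_eq (a := a) (b := b) he
    exact (card_eval_eq_le (by omega) t).trans h1.le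
  refine IsGreatest.csSup_eq ⟨?_, ?_⟩
  · obtain ⟨S, hS0, hS1, hSc, hS⟩ := exists_exceptional_finset f (a₀ * a₂ / a₁ ^ 2) he
    have h2n : 2 ^ (n / 2) ≤ 2 ^ n := Nat.pow_le_pow_right two_pos (Nat.div_le_self _ _)
    obtain ⟨a, ha, w, hw⟩ := exists_artinSchreier_eq S hS0 (by omega) (j + 1) (a₀ * a₂ / a₁ ^ 2)
    have ha0 : a ≠ 0 := fun h => ha (h ▸ hS0)
    obtain ⟨t, s, hs, hst⟩ := diffPoly.exists_totally_split f hcard hj (a := a)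
      (fun h => ha (h ▸ hS1))
      (hS a ha) hM.2.2 (by exact_mod_cast hw) hn
    have hα : a * a₁ / a₀ ≠ 0 := div_ne_zero (mul_ne_zero ha0 ha₁) ha₀
    refine ⟨_, hα, t * (a₁ * (a * a₁ / a₀) ^ (4 * j + 2 + 1)), ?_⟩
    rw [card_eq_card_diffPoly ha₁ hα,
      mul_div_cancel_right₀ _ (mul_ne_zero ha₁ (pow_ne_zero _ hα)),
      show a₀ * (a * a₁ / a₀) / a₁ = a by field_simp,
      show a₂ / (a₁ * (a * a₁ / a₀)) = a₀ * a₂ / a₁ ^ 2 / a by field_simp]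
    exact le_antisymm (hs.symm.le.trans (s.card_le_card_subtype hst)) (hle _ _ _)
  · rintro _ ⟨α, hα, β, rfl⟩
    rw [card_eq_card_diffPoly ha₁ hα]
    exact hle _ _ _
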